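/- There exist constants C > 0 and ε₀ ∈ (0,1), depending only on n and Λ, with the following property. Set α = ε₀ e^{−4Λκ} ∈ (0,1). Then every solution φ satisfies the interior Hölder estimate |φ(x) − φ(y)| ≤ C e^{κ} |x − y|^{α} for all x, y ∈ B_{1/2}. -/

import Mathlib

open MeasureTheory Metric Real Set

/-- A (weak) solution of the quasilinear elliptic equation
`-∂ⱼ(aᵢⱼ(x,φ)∂ᵢφ) = ρ(x,φ)[1 - (1/2) f e^φ + F(x,φ,∇φ)]` on the unit ball `B₁ ⊆ ℝⁿ`,
which is continuously differentiable and satisfies `0 ≤ φ ≤ κ`. -/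
def IsSolution (n : ℕ) (κ : ℝ)
    (a : Fin n → Fin n → EuclideanSpace ℝ (Fin n) → ℝ → ℝ)
    (ρ : EuclideanSpace ℝ (Fin n) → ℝ → ℝ)
    (f : EuclideanSpace ℝ (Fin n) → ℝ)
    (F : EuclideanSpace ℝ (Fin n) → ℝ → EuclideanSpace ℝ (Fin n) → ℝ)
    (φ : EuclideanSpace ℝ (Fin n) → ℝ) : Prop :=
  ContDiffOn ℝ 1 φ (ball (0 : EuclideanSpace ℝ (Fin n)) 1) ∧
  (∀ x ∈ ball (0 : EuclideanSpace ℝ (Fin n)) 1, 0 ≤ φ x ∧ φ x ≤ κ) ∧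
  ∀ ψ : EuclideanSpace ℝ (Fin n) → ℝ,
    ContDiff ℝ (⊤ : ℕ∞) ψ → HasCompactSupport ψ →
    tsupport ψ ⊆ ball (0 : EuclideanSpace ℝ (Fin n)) 1 →
    (∫ x in ball (0 : EuclideanSpace ℝ (Fin n)) 1,
        ∑ i : Fin n, ∑ j : Fin n,
          a i j x (φ x) * fderiv ℝ φ x (EuclideanSpace.single i 1) *
            fderiv ℝ ψ x (EuclideanSpace.single j 1))
      = ∫ x in ball (0 : EuclideanSpace ℝ (Fin n)) 1,
          ρ x (φ x) * (1 - (1/2) * f x * Real.exp (φ x) + F x (φ x) (gradient φ x)) * ψ x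

/-- Structural assumptions on the coefficients: symmetry and `Λ`-ellipticity of `aᵢⱼ`,
`1/2 ≤ ρ ≤ 2`, `0 ≤ f ≤ 1`, the natural growth bound `|F(x,z,p)| ≤ |p|² + 1`,
and continuity of all coefficients. -/
def GoodCoeffs (n : ℕ) (Λ : ℝ)
    (a : Fin n → Fin n → EuclideanSpace ℝ (Fin n) → ℝ → ℝ)
    (ρ : EuclideanSpace ℝ (Fin n) → ℝ → ℝ)
    (f : EuclideanSpace ℝ (Fin n) → ℝ)
    (F : EuclideanSpace ℝ (Fin n) → ℝ → EuclideanSpace ℝ (Fin n) → ℝ) : Prop :=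
  (∀ i j, ContinuousOn (fun p : EuclideanSpace ℝ (Fin n) × ℝ => a i j p.1 p.2)
      ((ball (0 : EuclideanSpace ℝ (Fin n)) 1) ×ˢ (Set.univ : Set ℝ))) ∧
  (∀ i j x z, a i j x z = a j i x z) ∧
  (∀ x ∈ ball (0 : EuclideanSpace ℝ (Fin n)) 1, ∀ z : ℝ, ∀ ξ : EuclideanSpace ℝ (Fin n),
      Λ⁻¹ * ‖ξ‖ ^ 2 ≤ ∑ i : Fin n, ∑ j : Fin n, a i j x z * ξ i * ξ j ∧
      ∑ i : Fin n, ∑ j : Fin n, a i j x z * ξ i * ξ j ≤ Λ * ‖ξ‖ ^ 2) ∧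
  ContinuousOn (fun p : EuclideanSpace ℝ (Fin n) × ℝ => ρ p.1 p.2)
      ((ball (0 : EuclideanSpace ℝ (Fin n)) 1) ×ˢ (Set.univ : Set ℝ)) ∧
  (∀ x ∈ ball (0 : EuclideanSpace ℝ (Fin n)) 1, ∀ z : ℝ, 1/2 ≤ ρ x z ∧ ρ x z ≤ 2) ∧
  ContinuousOn f (ball (0 : EuclideanSpace ℝ (Fin n)) 1) ∧
  (∀ x ∈ ball (0 : EuclideanSpace ℝ (Fin n)) 1, 0 ≤ f x ∧ f x ≤ 1) ∧
  ContinuousOn (fun p : EuclideanSpace ℝ (Fin n) × ℝ × EuclideanSpace ℝ (Fin n) =>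
      F p.1 p.2.1 p.2.2)
      ((ball (0 : EuclideanSpace ℝ (Fin n)) 1) ×ˢ
        (Set.univ : Set (ℝ × EuclideanSpace ℝ (Fin n)))) ∧
  (∀ x ∈ ball (0 : EuclideanSpace ℝ (Fin n)) 1, ∀ (z : ℝ) (p : EuclideanSpace ℝ (Fin n)),
      |F x z p| ≤ ‖p‖ ^ 2 + 1)

section
set_option maxSynthPendingDepth 3

abbrev EE (n : ℕ) := EuclideanSpace ℝ (Fin n)
abbrev DD (n : ℕ) := EuclideanSpace ℝ (Fin n) →L[ℝ] ℝ

structure Ell (n : ℕ) (Λ : ℝ) (A : EE n → DD n →L[ℝ] DD n →L[ℝ] ℝ) : Prop where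
  cont : Continuous A
  symm : ∀ x p q, A x p q = A x q p
  lower : ∀ x p, Λ⁻¹ * ‖p‖ ^ 2 ≤ A x p p
  upper : ∀ x p, A x p p ≤ Λ * ‖p‖ ^ 2

def IsTest {n : ℕ} (ψ : EE n → ℝ) : Prop :=
  ContDiff ℝ 1 ψ ∧ HasCompactSupport ψ ∧ tsupport ψ ⊆ ball 0 1

def SubSol {n : ℕ} (A : EE n → DD n →L[ℝ] DD n →L[ℝ] ℝ) (u b : EE n → ℝ) : Prop :=
  ∀ ψ : EE n → ℝ, IsTest ψ → (∀ x, 0 ≤ ψ x) →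
    ∫ x, A x (fderiv ℝ u x) (fderiv ℝ ψ x) ≤ ∫ x, b x * ψ x

theorem Ell.young {n : ℕ} {Λ : ℝ} {A : EE n → DD n →L[ℝ] DD n →L[ℝ] ℝ} (hA : Ell n Λ A)
    (hΛ : 1 ≤ Λ) (x : EE n) (p q : DD n) : - (2 * A x p q) ≤ (1/2) * A x p p + 2 * A x q q := by
  have h := hA.lower x (p + (2:ℝ) • q)
  have h1 : 0 ≤ Λ⁻¹ * ‖p + (2:ℝ) • q‖ ^ 2 := by positivity
  have h2 : A x (p + (2:ℝ) • q) (p + (2:ℝ) • q) = A x p p + 4 * A x p q + 4 * A x q q := by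
    simp only [map_add, map_smul, add_apply, smul_apply,
      smul_eq_mul, hA.symm x q p]
    ring
  linarith

theorem Ell.nonneg {n : ℕ} {Λ : ℝ} {A : EE n → DD n →L[ℝ] DD n →L[ℝ] ℝ} (hA : Ell n Λ A)
    (hΛ : 1 ≤ Λ) (x : EE n) (p : DD n) : 0 ≤ A x p p :=
  le_trans (by positivity) (hA.lower x p)

theorem cont_fd {n : ℕ} {u : EE n → ℝ} (hu : ContDiff ℝ 1 u) : Continuous (fderiv ℝ u) :=
  hu.continuous_fderiv (by norm_num)

theorem cont_A {n : ℕ} {Λ : ℝ} {A : EE n → DD n →L[ℝ] DD n →L[ℝ] ℝ} (hA : Ell n Λ A)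
    {p q : EE n → DD n} (hp : Continuous p) (hq : Continuous q) :
    Continuous (fun x => A x (p x) (q x)) :=
  (hA.cont.clm_apply hp).clm_apply hq

theorem integrable_of_zero {n : ℕ} {f ψ : EE n → ℝ} (hf : Continuous f)
    (hψ : HasCompactSupport ψ) (h : ∀ x, x ∉ tsupport ψ → f x = 0) : Integrable f :=
  hf.integrable_of_hasCompactSupport (HasCompactSupport.of_support_subset_isCompact hψ
    (fun x hx => by by_contra hc; exact hx (h x hc)))

theorem test_zero {n : ℕ} {ψ : EE n → ℝ} {x : EE n} (h : x ∉ tsupport ψ) : ψ x = 0 :=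
  image_eq_zero_of_notMem_tsupport h

theorem test_fzero {n : ℕ} {ψ : EE n → ℝ} {x : EE n} (h : x ∉ tsupport ψ) : fderiv ℝ ψ x = 0 := by
  by_contra hc
  exact h (support_fderiv_subset ℝ hc)

theorem SubSol.mono {n : ℕ} {A : EE n → DD n →L[ℝ] DD n →L[ℝ] ℝ} {u b b' : EE n → ℝ}
    (h : SubSol A u b) (hb : Continuous b) (hb' : Continuous b') (hbb : ∀ x, b x ≤ b' x) :
    SubSol A u b' := by
  intro ψ hψ h0
  refine (h ψ hψ h0).trans (integral_mono ?_ ?_ ?_)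
  · exact integrable_of_zero (hb.mul hψ.1.continuous) hψ.2.1 (fun x hx => by simp [test_zero hx])
  · exact integrable_of_zero (hb'.mul hψ.1.continuous) hψ.2.1 (fun x hx => by simp [test_zero hx])
  · intro x
    exact mul_le_mul_of_nonneg_right (hbb x) (h0 x)

theorem SubSol.comp {n : ℕ} {Λ : ℝ} {A : EE n → DD n →L[ℝ] DD n →L[ℝ] ℝ} (hA : Ell n Λ A)
    {u b g h k : EE n → ℝ} (hs : SubSol A u b) (hu : ContDiff ℝ 1 u) (hb : Continuous b)
    (hh : ContDiff ℝ 1 h) (h0 : ∀ x, 0 ≤ h x) (hk : Continuous k)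
    (hg : ∀ x, fderiv ℝ g x = h x • fderiv ℝ u x)
    (hhk : ∀ x, fderiv ℝ h x = k x • fderiv ℝ u x) :
    SubSol A g (fun x => h x * b x - k x * A x (fderiv ℝ u x) (fderiv ℝ u x)) := by
  intro ψ hψ hψ0
  have hsub : tsupport (fun x => h x * ψ x) ⊆ tsupport ψ := tsupport_mul_subset_right
  have key := hs (fun x => h x * ψ x)
    ⟨hh.mul hψ.1, HasCompactSupport.mul_left hψ.2.1, hsub.trans hψ.2.2⟩
    (fun x => mul_nonneg (h0 x) (hψ0 x))
  have hD : ∀ x, fderiv ℝ (fun x => h x * ψ x) x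
      = h x • fderiv ℝ ψ x + ψ x • (k x • fderiv ℝ u x) := by
    intro x
    rw [← hhk, fderiv_fun_mul (hh.differentiable (by norm_num) x) (hψ.1.differentiable (by norm_num) x)]
  have cu := cont_fd hu
  have cψ := cont_fd hψ.1
  have ch := hh.continuous
  have cp := hψ.1.continuous
  have cuu := cont_A hA cu cu
  have cup := cont_A hA cu cψ
  have i1 : Integrable (fun x => h x * A x (fderiv ℝ u x) (fderiv ℝ ψ x)) :=
    integrable_of_zero (ch.mul cup) hψ.2.1 (fun x hx => by simp [test_fzero hx])
  have i2 : Integrable (fun x => k x * A x (fderiv ℝ u x) (fderiv ℝ u x) * ψ x) :=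
    integrable_of_zero ((hk.mul cuu).mul cp) hψ.2.1 (fun x hx => by simp [test_zero hx])
  have i3 : Integrable (fun x => b x * (h x * ψ x)) :=
    integrable_of_zero (hb.mul (ch.mul cp)) hψ.2.1 (fun x hx => by simp [test_zero hx])
  have e1 : ∫ x, A x (fderiv ℝ u x) (fderiv ℝ (fun x => h x * ψ x) x)
      = (∫ x, h x * A x (fderiv ℝ u x) (fderiv ℝ ψ x))
        + ∫ x, k x * A x (fderiv ℝ u x) (fderiv ℝ u x) * ψ x := by
    rw [← integral_add i1 i2]
    congr 1; ext x
    rw [hD]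
    simp only [map_add, map_smul, smul_eq_mul]
    ring
  have e2 : ∫ x, A x (fderiv ℝ g x) (fderiv ℝ ψ x)
      = ∫ x, h x * A x (fderiv ℝ u x) (fderiv ℝ ψ x) := by
    congr 1; ext x
    rw [hg]
    simp only [map_smul, smul_apply, smul_eq_mul]
  have e3 : ∫ x, (h x * b x - k x * A x (fderiv ℝ u x) (fderiv ℝ u x)) * ψ x
      = (∫ x, b x * (h x * ψ x)) - ∫ x, k x * A x (fderiv ℝ u x) (fderiv ℝ u x) * ψ x := by
    rw [← integral_sub i3 i2]
    congr 1; ext x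
    ring
  rw [e1] at key
  rw [e2, e3]
  linarith

theorem lintegral_affine {n : ℕ} (f : EE n → ENNReal) (hf : Measurable f) (a : EE n) {t : ℝ}
    (ht : 0 < t) : ∫⁻ x, f (a + t • x) = ENNReal.ofReal ((t ^ n)⁻¹) * ∫⁻ x, f x := by
  have h1 : ∫⁻ x, f (a + t • x) = ∫⁻ x, f (a + x) ∂(Measure.map (t • ·) volume) := by
    rw [lintegral_map (f := fun x => f (a + x)) (hf.comp (measurable_const_add a)) (measurable_const_smul t)]
  rw [h1, Measure.map_addHaar_smul volume ht.ne', lintegral_smul_measure,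
    lintegral_add_left_eq_self]
  simp [abs_of_pos ht]

theorem lintegral_half {n : ℕ} (f : EE n → ENNReal) (hf : Measurable f) {ρ : ℝ} {y : EE n}
    (hy : y ∈ ball (0 : EE n) ρ) {t : ℝ} (ht : 1/2 ≤ t) (ht1 : t ≤ 1) :
    ∫⁻ x in ball (0 : EE n) ρ, f ((1 - t) • y + t • x)
      ≤ ENNReal.ofReal (2 ^ n) * ∫⁻ x in ball (0 : EE n) ρ, f x := by
  have hm : MeasurableSet (ball (0 : EE n) ρ) := measurableSet_ball
  rw [← lintegral_indicator hm, ← lintegral_indicator hm f]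
  have h1 := lintegral_affine ((ball (0 : EE n) ρ).indicator f) (hf.indicator hm) ((1 - t) • y)
    (lt_of_lt_of_le (by norm_num) ht)
  calc _ ≤ ∫⁻ x, (ball (0 : EE n) ρ).indicator f ((1 - t) • y + t • x) := by
        apply lintegral_mono
        intro x
        by_cases hx : x ∈ ball (0 : EE n) ρ
        · have : (1 - t) • y + t • x ∈ ball (0 : EE n) ρ :=
            (convex_ball (0 : EE n) ρ) hy hx (by linarith) (by linarith) (by ring)
          simp [indicator_of_mem hx, indicator_of_mem this]
        · simp [indicator_of_notMem hx]
    _ = _ := h1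
    _ ≤ _ := by
        gcongr
        have h2 : (1/2 : ℝ) ^ n ≤ t ^ n := by gcongr
        calc (t ^ n)⁻¹ ≤ ((1/2 : ℝ) ^ n)⁻¹ := by gcongr
          _ = 2 ^ n := by simp

theorem seg_bound {n : ℕ} {v : EE n → ℝ} (hv : ContDiff ℝ 1 v) {ρ : ℝ} (hρ : ρ ≤ 1) {x y : EE n}
    (hx : x ∈ ball (0 : EE n) ρ) (hy : y ∈ ball (0 : EE n) ρ) :
    ENNReal.ofReal ((v x - v y) ^ 2) ≤ 4 * ∫⁻ t in Icc (0:ℝ) 1,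
      ENNReal.ofReal (‖fderiv ℝ v ((1 - t) • y + t • x)‖ ^ 2) := by
  set g : ℝ → EE n := fun t => (1 - t) • y + t • x with hgdef
  have hgc : Continuous g := by fun_prop
  have hg' : ∀ t, HasDerivAt g (x - y) t := by
    intro t
    have h1 : HasDerivAt (fun t : ℝ => (1 - t) • y) ((-1 : ℝ) • y) t :=
      ((hasDerivAt_id t).const_sub 1).smul_const y
    have h2 : HasDerivAt (fun t : ℝ => t • x) ((1 : ℝ) • x) t := (hasDerivAt_id t).smul_const x
    have h3 := h1.add h2
    have e : (-1 : ℝ) • y + (1 : ℝ) • x = x - y := by rw [neg_smul, one_smul, one_smul]; abel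
    rw [e] at h3
    exact h3
  have cfd := cont_fd hv
  have hder : ∀ t, HasDerivAt (fun t => v (g t)) (fderiv ℝ v (g t) (x - y)) t := by
    intro t
    exact ((hv.differentiable (by norm_num) (g t)).hasFDerivAt).comp_hasDerivAt t (hg' t)
  have c1 : Continuous (fun t => fderiv ℝ v (g t) (x - y)) :=
    (cfd.comp hgc).clm_apply continuous_const
  have c2 : Continuous (fun t => ‖fderiv ℝ v (g t)‖ ^ 2) := ((cfd.comp hgc).norm.pow 2)
  have hftc : ∫ t in (0:ℝ)..1, fderiv ℝ v (g t) (x - y) = v x - v y := by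
    rw [intervalIntegral.integral_eq_sub_of_hasDerivAt (fun t _ => hder t)
      (c1.intervalIntegrable _ _)]
    simp [hgdef]
  set L := v x - v y
  have hxy : ‖x - y‖ ≤ 2 := by
    have := norm_sub_le x y
    rw [mem_ball_zero_iff] at hx hy
    linarith
  -- real inequality
  have hreal : L ^ 2 ≤ 4 * ∫ t in (0:ℝ)..1, ‖fderiv ℝ v (g t)‖ ^ 2 := by
    have hm : ∫ t in (0:ℝ)..1, (2 * L * fderiv ℝ v (g t) (x - y) - L ^ 2)
        ≤ ∫ t in (0:ℝ)..1, 4 * ‖fderiv ℝ v (g t)‖ ^ 2 := by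
      apply intervalIntegral.integral_mono_on (by norm_num)
        (((c1.const_mul _).sub continuous_const).intervalIntegrable _ _)
        ((c2.const_mul _).intervalIntegrable _ _)
      intro t _
      have h1 : |fderiv ℝ v (g t) (x - y)| ≤ ‖fderiv ℝ v (g t)‖ * 2 := by
        refine ((fderiv ℝ v (g t)).le_opNorm (x - y)).trans ?_
        gcongr
      have h2 : (fderiv ℝ v (g t) (x - y)) ^ 2 ≤ (‖fderiv ℝ v (g t)‖ * 2) ^ 2 := by
        rw [← sq_abs]; gcongr
      change 2 * L * fderiv ℝ v (g t) (x - y) - L ^ 2 ≤ 4 * ‖fderiv ℝ v (g t)‖ ^ 2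
      nlinarith [sq_nonneg (L - fderiv ℝ v (g t) (x - y))]
    rw [intervalIntegral.integral_sub ((c1.const_mul _).intervalIntegrable _ _)
      (continuous_const.intervalIntegrable _ _), intervalIntegral.integral_const_mul,
      intervalIntegral.integral_const_mul, hftc] at hm
    simp at hm
    nlinarith
  calc ENNReal.ofReal (L ^ 2) ≤ ENNReal.ofReal (4 * ∫ t in (0:ℝ)..1, ‖fderiv ℝ v (g t)‖ ^ 2) :=
        ENNReal.ofReal_le_ofReal hreal
    _ = 4 * ENNReal.ofReal (∫ t in Icc (0:ℝ) 1, ‖fderiv ℝ v (g t)‖ ^ 2) := by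
        rw [ENNReal.ofReal_mul (by norm_num), intervalIntegral.integral_of_le (by norm_num),
          integral_Icc_eq_integral_Ioc]
        simp
    _ = _ := by
        rw [ofReal_integral_eq_lintegral_ofReal (c2.integrableOn_Icc)
          (Filter.Eventually.of_forall (fun t => by positivity))]

theorem poincare {n : ℕ} {v : EE n → ℝ} (hv : ContDiff ℝ 1 v) {ρ : ℝ} (hρ0 : 0 < ρ) (hρ : ρ ≤ 1)
    {Z : Set (EE n)} (hZm : MeasurableSet Z) (hZ : Z ⊆ ball 0 ρ) (hv0 : ∀ x ∈ Z, v x ≤ 0)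
    (hZv : volume (ball (0 : EE n) ρ) ≤ 2 * volume Z) :
    ∫⁻ x in ball (0 : EE n) ρ, ENNReal.ofReal ((max (v x) 0) ^ 2)
      ≤ 8 * ENNReal.ofReal (2 ^ n) *
        ∫⁻ x in ball (0 : EE n) ρ, ENNReal.ofReal (‖fderiv ℝ v x‖ ^ 2) := by
  set B := ball (0 : EE n) ρ with hB
  have hBm : MeasurableSet B := measurableSet_ball
  set f : EE n → ENNReal := fun x => ENNReal.ofReal (‖fderiv ℝ v x‖ ^ 2) with hf
  have hfm : Measurable f := by
    have : Continuous f := ENNReal.continuous_ofReal.comp ((cont_fd hv).norm.pow 2)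
    exact this.measurable
  have hBpos : volume B ≠ 0 := (measure_ball_pos volume _ hρ0).ne'
  have hBfin : volume B ≠ ⊤ := measure_ball_lt_top.ne
  set I := ∫⁻ x in B, f x
  set J := ∫⁻ x in B, ENNReal.ofReal ((max (v x) 0) ^ 2)
  -- pointwise
  have h1 : volume Z * J ≤ ∫⁻ x in B, ∫⁻ y in B, 4 * ∫⁻ t in Icc (0:ℝ) 1,
      f ((1 - t) • y + t • x) := by
    rw [← lintegral_const_mul' _ _ ((measure_mono hZ).trans_lt measure_ball_lt_top).ne]
    apply setLIntegral_mono' hBm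
    intro x hx
    calc volume Z * ENNReal.ofReal ((max (v x) 0) ^ 2)
        = ∫⁻ y in Z, ENNReal.ofReal ((max (v x) 0) ^ 2) := by
          rw [setLIntegral_const, mul_comm]
      _ ≤ ∫⁻ y in Z, 4 * ∫⁻ t in Icc (0:ℝ) 1, f ((1 - t) • y + t • x) := by
          apply setLIntegral_mono' hZm
          intro y hy
          refine le_trans (ENNReal.ofReal_le_ofReal ?_) (seg_bound hv hρ hx (hZ hy))
          have := hv0 y hy
          rcases le_total (v x) 0 with h | h
          · rw [max_eq_right h]; nlinarith [sq_nonneg (v x - v y)]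
          · rw [max_eq_left h]; nlinarith
      _ ≤ _ := lintegral_mono_set hZ
  have hm3 : Measurable (fun q : (EE n × EE n) × ℝ => f ((1 - q.2) • q.1.2 + q.2 • q.1.1)) :=
    hfm.comp (by fun_prop)
  have h2 : ∫⁻ x in B, ∫⁻ y in B, 4 * ∫⁻ t in Icc (0:ℝ) 1, f ((1 - t) • y + t • x)
      = 4 * ∫⁻ t in Icc (0:ℝ) 1, ∫⁻ x in B, ∫⁻ y in B, f ((1 - t) • y + t • x) := by
    have e1 : ∀ x, ∫⁻ y in B, 4 * ∫⁻ t in Icc (0:ℝ) 1, f ((1 - t) • y + t • x)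
        = 4 * ∫⁻ t in Icc (0:ℝ) 1, ∫⁻ y in B, f ((1 - t) • y + t • x) := by
      intro x
      rw [lintegral_const_mul' _ _ (by norm_num), lintegral_lintegral_swap]
      exact (hfm.comp (by fun_prop : Measurable
        (fun q : EE n × ℝ => (1 - q.2) • q.1 + q.2 • x))).aemeasurable
    simp_rw [e1]
    rw [lintegral_const_mul' _ _ (by norm_num), lintegral_lintegral_swap]
    have : Measurable (fun q : (EE n × ℝ) => ∫⁻ y in B, f ((1 - q.2) • y + q.2 • q.1)) := by
      apply Measurable.lintegral_prod_right' (f := fun q : (EE n × ℝ) × EE n =>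
        f ((1 - q.1.2) • q.2 + q.1.2 • q.1.1))
      exact hfm.comp (by fun_prop)
    exact this.aemeasurable
  have h3 : ∀ t ∈ Icc (0:ℝ) 1, ∫⁻ x in B, ∫⁻ y in B, f ((1 - t) • y + t • x)
      ≤ volume B * (ENNReal.ofReal (2 ^ n) * I) := by
    intro t ht
    have hconst : ∫⁻ x in B, (ENNReal.ofReal (2 ^ n) * I) = volume B * (ENNReal.ofReal (2 ^ n) * I) := by
      rw [setLIntegral_const, mul_comm]
    rcases le_total t (1/2) with h | h
    · rw [← hconst]
      apply setLIntegral_mono' hBm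
      intro x hx
      have := lintegral_half f hfm hx (t := 1 - t) (by linarith) (by linarith [ht.1])
      refine le_trans (le_of_eq ?_) this
      congr 1; ext y
      congr 1
      rw [add_comm]; congr 2; ring
    · rw [lintegral_lintegral_swap]
      · rw [← hconst]
        apply setLIntegral_mono' hBm
        intro y hy
        exact lintegral_half f hfm hy h ht.2
      · exact (hfm.comp (by fun_prop : Measurable
          (fun q : EE n × EE n => (1 - t) • q.2 + t • q.1))).aemeasurable
  have h4 : volume Z * J ≤ 4 * (volume B * (ENNReal.ofReal (2 ^ n) * I)) := by
    refine h1.trans (h2.le.trans ?_)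
    gcongr
    calc _ ≤ ∫⁻ t in Icc (0:ℝ) 1, volume B * (ENNReal.ofReal (2 ^ n) * I) :=
          setLIntegral_mono' measurableSet_Icc h3
      _ = _ := by rw [setLIntegral_const]; simp
  have h5 : volume B * J ≤ volume B * (8 * ENNReal.ofReal (2 ^ n) * I) := by
    calc volume B * J ≤ 2 * volume Z * J := by gcongr
      _ = 2 * (volume Z * J) := by ring
      _ ≤ 2 * (4 * (volume B * (ENNReal.ofReal (2 ^ n) * I))) := by gcongr
      _ = _ := by ring
  exact (ENNReal.mul_le_mul_iff_right hBpos hBfin).1 h5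

theorem smoothTransition_deriv_bound : ∃ K : ℝ, 1 ≤ K ∧ ∀ t, |deriv Real.smoothTransition t| ≤ K := by
  have hc : Continuous (deriv Real.smoothTransition) :=
    (Real.smoothTransition.contDiff (n := 1)).continuous_deriv (by norm_num)
  obtain ⟨K, hK⟩ := (isCompact_Icc (a := (0:ℝ)) (b := 1)).exists_bound_of_continuousOn hc.continuousOn
  refine ⟨max K 1, le_max_right _ _, fun t => ?_⟩
  rcases lt_or_ge t 0 with h | h
  · have : Real.smoothTransition =ᶠ[nhds t] fun _ => 0 := by
      filter_upwards [Iio_mem_nhds h] with s hs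
      exact Real.smoothTransition.zero_of_nonpos (le_of_lt hs)
    rw [this.deriv_eq]; simp
  · rcases lt_or_ge 1 t with h1 | h1
    · have : Real.smoothTransition =ᶠ[nhds t] fun _ => 1 := by
        filter_upwards [Ioi_mem_nhds h1] with s hs
        exact Real.smoothTransition.one_of_one_le (le_of_lt hs)
      rw [this.deriv_eq]; simp
    · exact (hK t ⟨h, h1⟩).trans (le_max_left _ _)

theorem exists_cutoff : ∃ L : ℝ, 1 ≤ L ∧ ∀ (n : ℕ) (r' r : ℝ), 0 < r' → r' < r →
    ∃ η : EE n → ℝ, ContDiff ℝ (⊤ : ℕ∞) η ∧ (∀ x, 0 ≤ η x) ∧ (∀ x, η x ≤ 1) ∧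
      (∀ x ∈ closedBall (0 : EE n) r', η x = 1) ∧ tsupport η ⊆ closedBall 0 r ∧
      HasCompactSupport η ∧ ∀ x, ‖fderiv ℝ η x‖ ≤ L / (r - r') := by
  obtain ⟨K, hK1, hK⟩ := smoothTransition_deriv_bound
  refine ⟨2 * K, by linarith, fun n r' r hr' hr => ?_⟩
  set D := r ^ 2 - r' ^ 2 with hD
  have hDpos : 0 < D := by nlinarith
  set q : EE n → ℝ := fun x => (r ^ 2 - ‖x‖ ^ 2) / D with hq
  have hqc : ContDiff ℝ (⊤ : ℕ∞) q := (contDiff_const.sub (contDiff_norm_sq ℝ)).div_const D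
  have hts : tsupport (fun x => Real.smoothTransition (q x)) ⊆ closedBall 0 r := by
    apply closure_minimal _ isClosed_closedBall
    intro x hx
    by_contra hc
    apply hx
    apply Real.smoothTransition.zero_of_nonpos
    rw [mem_closedBall_zero_iff, not_le] at hc
    apply div_nonpos_of_nonpos_of_nonneg _ hDpos.le
    nlinarith
  refine ⟨fun x => Real.smoothTransition (q x), Real.smoothTransition.contDiff.comp hqc,
    fun x => Real.smoothTransition.nonneg _, fun x => Real.smoothTransition.le_one _, ?_, hts,
    (isCompact_closedBall 0 r).of_isClosed_subset (isClosed_tsupport _) hts, ?_⟩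
  · intro x hx
    apply Real.smoothTransition.one_of_one_le
    rw [mem_closedBall_zero_iff] at hx
    rw [hq, le_div_iff₀ hDpos]
    have := norm_nonneg x
    nlinarith
  · intro x
    by_cases hx : x ∈ tsupport (fun x => Real.smoothTransition (q x))
    · have hxr := mem_closedBall_zero_iff.1 (hts hx)
      have hqd : HasFDerivAt q (-(D⁻¹ • ((2:ℝ) • innerSL ℝ x))) x := by
        have h1 : HasFDerivAt (fun x : EE n => ‖x‖ ^ 2) ((2:ℝ) • innerSL ℝ x) x := by
          have := (hasStrictFDerivAt_norm_sq x).hasFDerivAt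
          simpa [two_smul] using this
        have h2 := (h1.const_sub (r ^ 2)).mul_const D⁻¹
        rw [smul_neg] at h2
        simpa [hq, div_eq_mul_inv] using h2
      have hS : HasDerivAt Real.smoothTransition (deriv Real.smoothTransition (q x)) (q x) :=
        ((Real.smoothTransition.contDiff (n := 1)).differentiable (by norm_num) (q x)).hasDerivAt
      have hfe : fderiv ℝ (fun x => Real.smoothTransition (q x)) x = _ :=
        (hS.comp_hasFDerivAt x hqd).fderiv
      rw [hfe, norm_smul, norm_neg, norm_smul, norm_smul,
        innerSL_apply_norm]
      have h3 : ‖D⁻¹‖ * (‖(2:ℝ)‖ * ‖x‖) ≤ 2 / (r - r') := by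
        rw [norm_inv, Real.norm_of_nonneg hDpos.le, Real.norm_two, ← div_eq_inv_mul,
          div_le_div_iff₀ hDpos (by linarith)]
        have : (r - r') * ‖x‖ ≤ (r - r') * (r + r') := by
          apply mul_le_mul_of_nonneg_left _ (by linarith); linarith
        nlinarith
      calc _ ≤ K * (2 / (r - r')) := by
            apply mul_le_mul (hK _) h3 (by positivity) (by linarith)
        _ = _ := by ring
    · rw [test_fzero hx, norm_zero]
      apply div_nonneg (by linarith) (by linarith)

theorem moser_iter (χ C b : ℝ) (hχ : 1 < χ) (hC : 1 ≤ C) (hb : 1 ≤ b) :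
    ∃ s : ℝ, 0 < s ∧ ∀ I : ℕ → ℝ, (∀ k, 0 ≤ I k) → (∀ k, I (k+1) ≤ (C * b ^ k * I k) ^ χ) →
      ∀ k, I k ≤ (s * I 0) ^ (χ ^ k) * s⁻¹ := by
  have hχ1 : 0 < χ - 1 := by linarith
  set B := b ^ (χ / (χ - 1)) with hB
  have hB1 : 1 ≤ B := Real.one_le_rpow hb (by positivity)
  have hB0 : 0 < B := by linarith
  have hb0 : 0 < b := by linarith
  have hC0 : 0 < C := by linarith
  set s := (C ^ χ * B) ^ (1 / (χ - 1)) with hs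
  have hs0 : 0 < s := by positivity
  have f1 : B ^ χ = b ^ χ * B := by
    have : B ^ (χ - 1) = b ^ χ := by
      rw [hB, ← Real.rpow_mul hb0.le]; congr 1; field_simp
    rw [← this]
    nth_rewrite 3 [← Real.rpow_one B]
    rw [← Real.rpow_add hB0]; congr 1; ring
  have f2 : s ^ χ = C ^ χ * B * s := by
    have : s ^ (χ - 1) = C ^ χ * B := by
      rw [hs, ← Real.rpow_mul (by positivity)]
      rw [one_div_mul_cancel hχ1.ne', Real.rpow_one]
    rw [← this]
    nth_rewrite 3 [← Real.rpow_one s]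
    rw [← Real.rpow_add hs0]; congr 1; ring
  clear_value B s
  refine ⟨s, hs0, fun I hI0 hI => ?_⟩
  have key : ∀ k, I k ≤ (s * I 0) ^ (χ ^ k) * (s * B ^ k)⁻¹ := by
    intro k
    induction k with
    | zero => simp; rw [mul_comm s, mul_assoc, mul_inv_cancel₀ hs0.ne', mul_one]
    | succ k ih =>
      refine (hI k).trans ?_
      have hX : 0 ≤ (s * I 0) ^ (χ ^ k) := Real.rpow_nonneg (mul_nonneg hs0.le (hI0 0)) _
      have hX2 : ((s * I 0) ^ (χ ^ k)) ^ χ = (s * I 0) ^ (χ ^ (k+1)) := by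
        rw [← Real.rpow_mul (mul_nonneg hs0.le (hI0 0)), pow_succ]
      set X := (s * I 0) ^ (χ ^ k)
      calc (C * b ^ k * I k) ^ χ ≤ (C * b ^ k * (X * (s * B ^ k)⁻¹)) ^ χ := by
            apply Real.rpow_le_rpow _ _ (by linarith)
            · have := hI0 k; positivity
            · gcongr
        _ = C ^ χ * (b ^ χ) ^ k * (X ^ χ * (s ^ χ * (B ^ χ) ^ k)⁻¹) := by
            rw [Real.mul_rpow (by positivity) (by positivity), Real.mul_rpow (by positivity) (by positivity),
              Real.mul_rpow (by positivity) (by positivity), Real.inv_rpow (by positivity),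
              Real.mul_rpow (by positivity) (by positivity), Real.rpow_pow_comm hb0.le χ k,
              Real.rpow_pow_comm hB0.le χ k]
        _ = _ := by
            rw [f1, f2, hX2, mul_pow]
            have : 0 < b ^ χ := by positivity
            have : 0 < C ^ χ := by positivity
            field_simp
            ring
  intro k
  refine (key k).trans ?_
  apply mul_le_mul_of_nonneg_left _ (Real.rpow_nonneg (mul_nonneg hs0.le (hI0 0)) _)
  apply inv_anti₀ hs0
  exact le_mul_of_one_le_right hs0.le (one_le_pow₀ hB1)

theorem sobolev_real (n : ℕ) (hn : 2 ≤ n) : ∃ C : ℝ, 1 ≤ C ∧ ∀ w : EE n → ℝ, ContDiff ℝ 1 w →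
    HasCompactSupport w →
    ∫ x, |w x| ^ ((n:ℝ) / (n - 1)) ≤ (C * ∫ x, ‖fderiv ℝ w x‖) ^ ((n:ℝ) / (n - 1)) := by
  have hn1 : (1:ℝ) < n := by exact_mod_cast hn
  set χ : ℝ := (n:ℝ) / (n - 1) with hχ
  have hχ0 : 0 < χ := by apply div_pos <;> linarith
  set p : NNReal := ⟨χ, hχ0.le⟩ with hp
  have hpc : NNReal.HolderConjugate (Module.finrank ℝ (EE n)) p := by
    rw [finrank_euclideanSpace_fin]
    have : (n:ℝ).HolderConjugate χ := Real.HolderConjugate.conjExponent hn1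
    rw [← NNReal.holderConjugate_coe_iff]
    exact this
  set C0 := eLpNormLESNormFDerivOneConst (volume : Measure (EE n)) (p : ℝ) with hC0
  refine ⟨max C0 1, le_max_right _ _, fun w hw hc => ?_⟩
  have h := eLpNorm_le_eLpNorm_fderiv_one volume hw hc hpc
  have hfd := cont_fd hw
  have i2 : Integrable (fderiv ℝ w) := hfd.integrable_of_hasCompactSupport (hc.fderiv ℝ)
  have hi1 : Integrable (fun x => |w x| ^ χ) := by
    apply integrable_of_zero (hw.continuous.abs.rpow_const (fun x => Or.inr hχ0.le)) hc
    intro x hx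
    simp [test_zero hx, Real.zero_rpow hχ0.ne']
  have e1 : eLpNorm w p volume = (ENNReal.ofReal (∫ x, |w x| ^ χ)) ^ (1/χ) := by
    rw [eLpNorm_eq_lintegral_rpow_enorm_toReal (by
      rw [Ne, ENNReal.coe_eq_zero]
      exact fun h => hχ0.ne' (congrArg NNReal.toReal h)) (by simp)]
    rw [ofReal_integral_eq_lintegral_ofReal hi1 (Filter.Eventually.of_forall fun x => by positivity)]
    simp only [ENNReal.coe_toReal]
    change (∫⁻ x, ‖w x‖ₑ ^ χ) ^ (1/χ) = _
    congr 2; ext x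
    rw [← ENNReal.ofReal_rpow_of_nonneg (abs_nonneg _) hχ0.le, Real.enorm_eq_ofReal_abs]
  have e2 : eLpNorm (fderiv ℝ w) 1 volume = ENNReal.ofReal (∫ x, ‖fderiv ℝ w x‖) := by
    rw [eLpNorm_one_eq_lintegral_enorm, ofReal_integral_norm_eq_lintegral_enorm i2]
  rw [e1, e2] at h
  have hI0 : 0 ≤ ∫ x, |w x| ^ χ := integral_nonneg fun x => by positivity
  have hD0 : 0 ≤ ∫ x, ‖fderiv ℝ w x‖ := integral_nonneg fun x => by positivity
  rw [ENNReal.ofReal_rpow_of_nonneg hI0 (by positivity)] at h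
  have h' : (∫ x, |w x| ^ χ) ^ (1/χ) ≤ C0 * ∫ x, ‖fderiv ℝ w x‖ := by
    rw [← ENNReal.ofReal_coe_nnreal, ← ENNReal.ofReal_mul (by positivity)] at h
    exact (ENNReal.ofReal_le_ofReal_iff (by positivity)).1 h
  calc ∫ x, |w x| ^ χ = ((∫ x, |w x| ^ χ) ^ (1/χ)) ^ χ := by
        rw [← Real.rpow_mul hI0, one_div_mul_cancel hχ0.ne', Real.rpow_one]
    _ ≤ _ := by
        apply Real.rpow_le_rpow (by positivity) _ hχ0.le
        refine h'.trans ?_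
        gcongr
        exact le_max_left _ _

theorem contDiff_gpow {n : ℕ} {g : EE n → ℝ} (hg : ContDiff ℝ 1 g) (g1 : ∀ x, 1 ≤ g x) (a : ℝ) :
    ContDiff ℝ 1 (fun x => g x ^ a) :=
  hg.rpow_const_of_ne (fun x => by linarith [g1 x])

theorem fderiv_gpow {n : ℕ} {g η : EE n → ℝ} (hg : ContDiff ℝ 1 g) (g1 : ∀ x, 1 ≤ g x)
    (hη : ContDiff ℝ 1 η) (a : ℝ) (x : EE n) :
    fderiv ℝ (fun x => η x ^ 2 * g x ^ a) x
      = (2 * η x * g x ^ a) • fderiv ℝ η x + (a * η x ^ 2 * g x ^ (a - 1)) • fderiv ℝ g x := by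
  have h1 : HasFDerivAt g (fderiv ℝ g x) x := (hg.differentiable (by norm_num) x).hasFDerivAt
  have h2 : HasFDerivAt η (fderiv ℝ η x) x := (hη.differentiable (by norm_num) x).hasFDerivAt
  have h3 := h1.rpow_const (p := a) (Or.inl (by linarith [g1 x]))
  have h4 := (h2.pow 2).mul h3
  have e : fderiv ℝ (fun x => η x ^ 2 * g x ^ a) x = _ := h4.fderiv
  rw [e]
  ext v
  simp
  ring

theorem cacc {n : ℕ} {Λ : ℝ} (hΛ : 1 ≤ Λ) {A : EE n → DD n →L[ℝ] DD n →L[ℝ] ℝ} (hA : Ell n Λ A)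
    {g η : EE n → ℝ} (hg : ContDiff ℝ 1 g) (g1 : ∀ x, 1 ≤ g x) (hs : SubSol A g g)
    (hη : ContDiff ℝ 1 η) (η0 : ∀ x, 0 ≤ η x) (η1 : ∀ x, η x ≤ 1) {r : ℝ} (hr : r < 1)
    (hηs : tsupport η ⊆ closedBall 0 r) (hηc : HasCompactSupport η) {N : ℝ} (hN : 1 ≤ N)
    (hηN : ∀ x, ‖fderiv ℝ η x‖ ≤ N) {q : ℝ} (hq : 2 ≤ q) :
    ∫ x, η x ^ 2 * g x ^ (q - 2) * ‖fderiv ℝ g x‖ ^ 2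
      ≤ 6 * Λ ^ 2 * N ^ 2 * ∫ x in closedBall (0 : EE n) r, g x ^ q := by
  have cg := hg.continuous
  have cη := hη.continuous
  have cgd := cont_fd hg
  have cηd := cont_fd hη
  have cpow : ∀ a : ℝ, Continuous (fun x => g x ^ a) := fun a => (contDiff_gpow hg g1 a).continuous
  have gpos : ∀ x, 0 < g x := fun x => by linarith [g1 x]
  set ψ : EE n → ℝ := fun x => η x ^ 2 * g x ^ (q - 1) with hψ
  have hψ1 : ContDiff ℝ 1 ψ := (hη.pow 2).mul (contDiff_gpow hg g1 _)
  have hψs : tsupport ψ ⊆ tsupport η := by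
    have : ψ = fun x => η x * (η x * g x ^ (q - 1)) := by ext x; simp only [hψ]; ring
    rw [this]
    exact tsupport_mul_subset_left
  have hψc : HasCompactSupport ψ := hηc.of_isClosed_subset (isClosed_tsupport _) hψs
  have hsol := hs ψ ⟨hψ1, hψc, hψs.trans (hηs.trans (closedBall_subset_ball hr))⟩
    (fun x => mul_nonneg (sq_nonneg _) (Real.rpow_nonneg (gpos x).le _))
  have c1 : Continuous (fun x => A x (fderiv ℝ g x) (fderiv ℝ ψ x)) := cont_A hA cgd (cont_fd hψ1)
  have c2 : Continuous (fun x => g x ^ q * A x (fderiv ℝ η x) (fderiv ℝ η x)) :=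
    (cpow q).mul (cont_A hA cηd cηd)
  have cP : Continuous (fun x => η x ^ 2 * g x ^ (q - 2) * A x (fderiv ℝ g x) (fderiv ℝ g x)) :=
    ((cη.pow 2).mul (cpow _)).mul (cont_A hA cgd cgd)
  have cP' : Continuous (fun x => η x ^ 2 * g x ^ (q - 2) * ‖fderiv ℝ g x‖ ^ 2) :=
    ((cη.pow 2).mul (cpow _)).mul (cgd.norm.pow 2)
  have i1 : Integrable (fun x => A x (fderiv ℝ g x) (fderiv ℝ ψ x)) :=
    integrable_of_zero c1 hψc (fun x hx => by simp [test_fzero hx])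
  have i2 : Integrable (fun x => g x ^ q * A x (fderiv ℝ η x) (fderiv ℝ η x)) :=
    integrable_of_zero c2 hηc (fun x hx => by simp [test_fzero hx])
  have iP : Integrable (fun x => η x ^ 2 * g x ^ (q - 2) * A x (fderiv ℝ g x) (fderiv ℝ g x)) :=
    integrable_of_zero cP hηc (fun x hx => by simp [test_zero hx])
  have iP' : Integrable (fun x => η x ^ 2 * g x ^ (q - 2) * ‖fderiv ℝ g x‖ ^ 2) :=
    integrable_of_zero cP' hηc (fun x hx => by simp [test_zero hx])
  have i3 : Integrable (fun x => g x * ψ x) :=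
    integrable_of_zero (cg.mul hψ1.continuous) hψc (fun x hx => by simp [test_zero hx])
  have hpt : ∀ x, (1/2) * (η x ^ 2 * g x ^ (q - 2) * A x (fderiv ℝ g x) (fderiv ℝ g x))
      ≤ A x (fderiv ℝ g x) (fderiv ℝ ψ x) + 2 * (g x ^ q * A x (fderiv ℝ η x) (fderiv ℝ η x)) := by
    intro x
    have hy := hA.young hΛ x (η x • fderiv ℝ g x) (g x • fderiv ℝ η x)
    simp only [map_smul, smul_apply, smul_eq_mul] at hy
    have hpos := hA.nonneg hΛ x (fderiv ℝ g x)
    rw [hψ, fderiv_gpow hg g1 hη]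
    simp only [map_add, map_smul, smul_eq_mul]
    have e1 : g x ^ q = g x ^ (q - 2) * g x ^ 2 := by
      rw [← Real.rpow_natCast, ← Real.rpow_add (gpos x)]; norm_num
    have e2 : g x ^ (q - 1) = g x ^ (q - 2) * g x := by
      nth_rewrite 3 [← Real.rpow_one (g x)]
      rw [← Real.rpow_add (gpos x)]; congr 1; ring
    have e3 : q - 1 - 1 = q - 2 := by ring
    rw [e3, e1, e2]
    have hgp : 0 < g x ^ (q - 2) := Real.rpow_pos_of_pos (gpos x) _
    have hm := mul_le_mul_of_nonneg_left hy hgp.le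
    have hPn : 0 ≤ (q - 2) * (η x ^ 2 * g x ^ (q - 2) * A x (fderiv ℝ g x) (fderiv ℝ g x)) := by
      have : 0 ≤ q - 2 := by linarith
      positivity
    linarith
  have hintg : (1/2) * ∫ x, η x ^ 2 * g x ^ (q - 2) * A x (fderiv ℝ g x) (fderiv ℝ g x)
      ≤ (∫ x, A x (fderiv ℝ g x) (fderiv ℝ ψ x))
        + 2 * ∫ x, g x ^ q * A x (fderiv ℝ η x) (fderiv ℝ η x) := by
    rw [← integral_const_mul, ← integral_const_mul, ← integral_add i1 (i2.const_mul 2)]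
    exact integral_mono (iP.const_mul _) (i1.add (i2.const_mul 2)) hpt
  have hSm : MeasurableSet (closedBall (0 : EE n) r) := measurableSet_closedBall
  have iS : IntegrableOn (fun x => g x ^ q) (closedBall (0 : EE n) r) :=
    (cpow q).continuousOn.integrableOn_compact (isCompact_closedBall 0 r)
  have iSi : ∀ c : ℝ, Integrable ((closedBall (0 : EE n) r).indicator (fun x => c * g x ^ q)) :=
    fun c => IntegrableOn.integrable_indicator (Integrable.const_mul iS c) hSm
  have hrhs : (∫ x, g x * ψ x) + 2 * ∫ x, g x ^ q * A x (fderiv ℝ η x) (fderiv ℝ η x)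
      ≤ 3 * Λ * N ^ 2 * ∫ x in closedBall (0 : EE n) r, g x ^ q := by
    rw [← integral_const_mul, ← integral_add i3 (i2.const_mul 2), ← integral_const_mul,
      ← integral_indicator hSm]
    apply integral_mono (i3.add (i2.const_mul 2)) (iSi _)
    intro x
    by_cases hx : x ∈ closedBall (0 : EE n) r
    · simp only [indicator_of_mem hx]
      have hup : A x (fderiv ℝ η x) (fderiv ℝ η x) ≤ Λ * N ^ 2 := by
        refine (hA.upper x _).trans ?_
        gcongr
        exact hηN x
      have hgq : 0 < g x ^ q := Real.rpow_pos_of_pos (gpos x) _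
      have e4 : g x * ψ x = η x ^ 2 * g x ^ q := by
        have : g x ^ q = g x ^ (q - 1) * g x := by
          nth_rewrite 3 [← Real.rpow_one (g x)]
          rw [← Real.rpow_add (gpos x)]; congr 1; ring
        simp only [hψ]; rw [this]; ring
      have h5 : η x ^ 2 ≤ 1 := by
        have := η0 x; have := η1 x; nlinarith
      have h6 : 1 ≤ Λ * N ^ 2 := by nlinarith [mul_le_mul hΛ (by nlinarith : 1 ≤ N ^ 2) (by norm_num) (by linarith)]
      change g x * ψ x + 2 * (g x ^ q * A x (fderiv ℝ η x) (fderiv ℝ η x)) ≤ _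
      rw [e4]
      nlinarith [mul_le_mul_of_nonneg_left hup hgq.le, mul_le_mul_of_nonneg_left h5 hgq.le,
        mul_le_mul_of_nonneg_left h6 hgq.le]
    · have hx' : x ∉ tsupport η := fun h => hx (hηs h)
      simp only [indicator_of_notMem hx]
      change g x * ψ x + 2 * (g x ^ q * A x (fderiv ℝ η x) (fderiv ℝ η x)) ≤ _
      simp [hψ, test_zero hx', test_fzero hx']
  have hlow : Λ⁻¹ * ∫ x, η x ^ 2 * g x ^ (q - 2) * ‖fderiv ℝ g x‖ ^ 2
      ≤ ∫ x, η x ^ 2 * g x ^ (q - 2) * A x (fderiv ℝ g x) (fderiv ℝ g x) := by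
    rw [← integral_const_mul]
    apply integral_mono (iP'.const_mul _) iP
    intro x
    have hgp : 0 < g x ^ (q - 2) := Real.rpow_pos_of_pos (gpos x) _
    have := mul_le_mul_of_nonneg_left (hA.lower x (fderiv ℝ g x))
      (mul_nonneg (sq_nonneg (η x)) hgp.le)
    simp only
    linarith
  have hfin : Λ⁻¹ * ∫ x, η x ^ 2 * g x ^ (q - 2) * ‖fderiv ℝ g x‖ ^ 2
      ≤ 6 * Λ * N ^ 2 * ∫ x in closedBall (0 : EE n) r, g x ^ q := by linarith
  rw [inv_mul_le_iff₀ (by linarith)] at hfin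
  linarith

theorem moser_step {n : ℕ} {Λ : ℝ} (hΛ : 1 ≤ Λ) {A : EE n → DD n →L[ℝ] DD n →L[ℝ] ℝ}
    (hA : Ell n Λ A) {CS χ : ℝ} (hCS : 1 ≤ CS) (hχ : 1 ≤ χ)
    (sob : ∀ w : EE n → ℝ, ContDiff ℝ 1 w → HasCompactSupport w →
      ∫ x, |w x| ^ χ ≤ (CS * ∫ x, ‖fderiv ℝ w x‖) ^ χ)
    {g η : EE n → ℝ} (hg : ContDiff ℝ 1 g) (g1 : ∀ x, 1 ≤ g x) (hs : SubSol A g g)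
    (hη : ContDiff ℝ 1 η) (η0 : ∀ x, 0 ≤ η x) (η1 : ∀ x, η x ≤ 1) {r r' : ℝ} (hr : r < 1)
    (hη' : ∀ x ∈ closedBall (0 : EE n) r', η x = 1)
    (hηs : tsupport η ⊆ closedBall 0 r) (hηc : HasCompactSupport η) {N : ℝ} (hN : 1 ≤ N)
    (hηN : ∀ x, ‖fderiv ℝ η x‖ ≤ N) {q : ℝ} (hq : 2 ≤ q) :
    ∫ x in closedBall (0 : EE n) r', g x ^ (q * χ)
      ≤ (CS * (6 * Λ ^ 2 * N ^ 2 * q) * ∫ x in closedBall (0 : EE n) r, g x ^ q) ^ χ := by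
  have hc := cacc hΛ hA hg g1 hs hη η0 η1 hr hηs hηc hN hηN hq
  have cgd := cont_fd hg
  have cpow : ∀ a : ℝ, Continuous (fun x => g x ^ a) := fun a => (contDiff_gpow hg g1 a).continuous
  have gpos : ∀ x, 0 < g x := fun x => by linarith [g1 x]
  set w : EE n → ℝ := fun x => η x ^ 2 * g x ^ q with hw
  have hw1 : ContDiff ℝ 1 w := (hη.pow 2).mul (contDiff_gpow hg g1 _)
  have hws : tsupport w ⊆ tsupport η := by
    have : w = fun x => η x * (η x * g x ^ q) := by ext x; simp only [hw]; ring
    rw [this]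
    exact tsupport_mul_subset_left
  have hwc : HasCompactSupport w := hηc.of_isClosed_subset (isClosed_tsupport _) hws
  have hS := sob w hw1 hwc
  have iP' : Integrable (fun x => η x ^ 2 * g x ^ (q - 2) * ‖fderiv ℝ g x‖ ^ 2) :=
    integrable_of_zero (((hη.continuous.pow 2).mul (cpow _)).mul (cgd.norm.pow 2)) hηc
      (fun x hx => by simp [test_zero hx])
  have iD : Integrable (fun x => ‖fderiv ℝ w x‖) :=
    integrable_of_zero (cont_fd hw1).norm hwc (fun x hx => by simp [test_fzero hx])
  have iw : Integrable (fun x => |w x| ^ χ) :=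
    integrable_of_zero (hw1.continuous.abs.rpow_const (fun x => Or.inr (by linarith))) hwc
      (fun x hx => by simp [test_zero hx, Real.zero_rpow (by linarith : χ ≠ 0)])
  have hSm : MeasurableSet (closedBall (0 : EE n) r) := measurableSet_closedBall
  have iS : IntegrableOn (fun x => g x ^ q) (closedBall (0 : EE n) r) :=
    (cpow q).continuousOn.integrableOn_compact (isCompact_closedBall 0 r)
  have iSi : ∀ c : ℝ, Integrable ((closedBall (0 : EE n) r).indicator (fun x => c * g x ^ q)) :=
    fun c => IntegrableOn.integrable_indicator (Integrable.const_mul iS c) hSm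
  set I := ∫ x in closedBall (0 : EE n) r, g x ^ q with hI
  have hI0 : 0 ≤ I := integral_nonneg fun x => Real.rpow_nonneg (gpos x).le _
  have hΛ2 : 1 ≤ Λ ^ 2 := by nlinarith
  have hN2 : 1 ≤ N ^ 2 := by nlinarith
  have hD : ∫ x, ‖fderiv ℝ w x‖ ≤ 6 * Λ ^ 2 * N ^ 2 * q * I := by
    have h1 : ∫ x, ‖fderiv ℝ w x‖ ≤ (2 * N + q / 2) * I
        + (q / 2) * ∫ x, η x ^ 2 * g x ^ (q - 2) * ‖fderiv ℝ g x‖ ^ 2 := by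
      rw [hI, ← integral_const_mul, ← integral_const_mul, ← integral_indicator hSm,
        ← integral_add (iSi _) (iP'.const_mul _)]
      apply integral_mono iD ((iSi _).add (iP'.const_mul _))
      intro x
      change ‖fderiv ℝ w x‖ ≤ indicator (closedBall (0 : EE n) r) (fun x => (2 * N + q / 2) * g x ^ q) x
        + q / 2 * (η x ^ 2 * g x ^ (q - 2) * ‖fderiv ℝ g x‖ ^ 2)
      by_cases hx : x ∈ closedBall (0 : EE n) r
      · rw [indicator_of_mem hx, hw, fderiv_gpow hg g1 hη]
        have hgp : 0 < g x ^ (q - 2) := Real.rpow_pos_of_pos (gpos x) _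
        have e1 : g x ^ q = g x ^ (q - 2) * g x ^ 2 := by
          rw [← Real.rpow_natCast, ← Real.rpow_add (gpos x)]; norm_num
        have e2 : g x ^ (q - 1) = g x ^ (q - 2) * g x := by
          nth_rewrite 3 [← Real.rpow_one (g x)]
          rw [← Real.rpow_add (gpos x)]; congr 1; ring
        have hη0 := η0 x
        have hη1 := η1 x
        have hg0 := gpos x
        refine (norm_add_le _ _).trans ?_
        rw [norm_smul, norm_smul, Real.norm_of_nonneg (by positivity),
          Real.norm_of_nonneg (by positivity), e1, e2]
        have t1 : η x * ‖fderiv ℝ η x‖ ≤ 1 * N := mul_le_mul hη1 (hηN x) (norm_nonneg _) (by norm_num)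
        have t1' := mul_le_mul_of_nonneg_left t1 (by positivity : 0 ≤ g x ^ (q - 2) * g x ^ 2)
        have t2 : 2 * (g x * ‖fderiv ℝ g x‖) ≤ g x ^ 2 + ‖fderiv ℝ g x‖ ^ 2 := by
          nlinarith [sq_nonneg (g x - ‖fderiv ℝ g x‖)]
        have t2' := mul_le_mul_of_nonneg_left t2 (by positivity : 0 ≤ q / 2 * (η x ^ 2 * g x ^ (q - 2)))
        have t3 : η x ^ 2 ≤ 1 := by nlinarith
        have t3' := mul_le_mul_of_nonneg_left t3 (by positivity : 0 ≤ q / 2 * (g x ^ (q - 2) * g x ^ 2))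
        linarith
      · have hx' : x ∉ tsupport w := fun h => hx (hηs (hws h))
        rw [indicator_of_notMem hx, test_fzero hx']
        have hgp : 0 < g x ^ (q - 2) := Real.rpow_pos_of_pos (gpos x) _
        simp only [norm_zero]
        positivity
    refine h1.trans ?_
    have h2 := mul_le_mul_of_nonneg_left hc (by linarith : 0 ≤ q / 2)
    have h3 : 2 * N + q / 2 ≤ 3 * Λ ^ 2 * N ^ 2 * q := by
      have k1 : N ≤ N ^ 2 := by nlinarith
      have k2 : N ^ 2 ≤ Λ ^ 2 * N ^ 2 := by nlinarith
      have k3 : 2 * (Λ ^ 2 * N ^ 2) ≤ (Λ ^ 2 * N ^ 2) * q := by nlinarith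
      have k4 : q * 1 ≤ q * (Λ ^ 2 * N ^ 2) := by
        apply mul_le_mul_of_nonneg_left _ (by linarith); linarith
      nlinarith
    have h4 := mul_le_mul_of_nonneg_right h3 hI0
    linarith
  have hL : ∫ x in closedBall (0 : EE n) r', g x ^ (q * χ) ≤ ∫ x, |w x| ^ χ := by
    calc ∫ x in closedBall (0 : EE n) r', g x ^ (q * χ)
        = ∫ x in closedBall (0 : EE n) r', |w x| ^ χ := by
          apply setIntegral_congr_fun measurableSet_closedBall
          intro x hx
          simp only [hw, hη' x hx]
          rw [one_pow, one_mul, abs_of_pos (Real.rpow_pos_of_pos (gpos x) _),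
            ← Real.rpow_mul (gpos x).le]
      _ ≤ _ := setIntegral_le_integral iw (Filter.Eventually.of_forall fun x => by
          exact Real.rpow_nonneg (abs_nonneg _) _)
  refine hL.trans (hS.trans ?_)
  apply Real.rpow_le_rpow _ _ (by linarith)
  · have : 0 ≤ ∫ x, ‖fderiv ℝ w x‖ := integral_nonneg fun x => norm_nonneg _
    positivity
  · rw [mul_assoc]
    gcongr

theorem sup_of_powers {n : ℕ} {g : EE n → ℝ} (cg : Continuous g) (g1 : ∀ x, 1 ≤ g x) {χ T s : ℝ}
    (hχ : 1 < χ) (hT : 0 ≤ T) (hs : 0 < s) {I : ℕ → ℝ} {r : ℕ → ℝ} (hr : ∀ k, 1/4 ≤ r k)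
    (hI : ∀ k, I k = ∫ x in closedBall (0 : EE n) (r k), g x ^ (2 * χ ^ k))
    (hb : ∀ k, I k ≤ T ^ (χ ^ k) * s⁻¹) : ∀ x ∈ ball (0 : EE n) (1/4), g x ^ 2 ≤ T := by
  intro x hx
  by_contra hlt
  rw [not_le] at hlt
  obtain ⟨T', hT1, hT2⟩ := exists_between hlt
  have gpos : ∀ x, 0 < g x := fun x => by linarith [g1 x]
  have hopen : IsOpen ({y | T' < g y ^ 2} ∩ ball (0 : EE n) (1/4)) :=
    (isOpen_lt continuous_const (cg.pow 2)).inter isOpen_ball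
  obtain ⟨δ, hδ, hsub⟩ := Metric.isOpen_iff.1 hopen x ⟨hT2, hx⟩
  set m := (volume (ball x δ)).toReal with hm
  have hmpos : 0 < m := ENNReal.toReal_pos (measure_ball_pos volume x hδ).ne' measure_ball_lt_top.ne
  have hT'0 : 0 < T' := by linarith
  have hk : ∀ k : ℕ, m * s ≤ (T / T') ^ (χ ^ k) := by
    intro k
    have h1 : m * T' ^ (χ ^ k) ≤ I k := by
      rw [hI]
      have cpow : Continuous (fun x => g x ^ (2 * χ ^ k)) :=
        cg.rpow_const (fun x => Or.inl (gpos x).ne')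
      calc m * T' ^ (χ ^ k) = ∫ y in ball x δ, T' ^ (χ ^ k) := by
            rw [setIntegral_const]; simp [hm, Measure.real]
        _ ≤ ∫ y in ball x δ, g y ^ (2 * χ ^ k) := by
            apply setIntegral_mono_on
            · exact integrableOn_const measure_ball_lt_top.ne
            · exact (cpow.continuousOn.integrableOn_compact (isCompact_closedBall x δ)).mono_set
                ball_subset_closedBall
            · exact measurableSet_ball
            · intro y hy
              rw [Real.rpow_mul (gpos y).le]
              have : T' < g y ^ 2 := (hsub hy).1
              apply Real.rpow_le_rpow hT'0.le _ (by positivity)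
              rw [Real.rpow_two]; exact this.le
        _ ≤ _ := by
            apply setIntegral_mono_set
            · exact cpow.continuousOn.integrableOn_compact (isCompact_closedBall _ _)
            · exact Filter.Eventually.of_forall fun y => Real.rpow_nonneg (gpos y).le _
            · apply HasSubset.Subset.eventuallyLE
              intro y hy
              exact closedBall_subset_closedBall (hr k) (ball_subset_closedBall (hsub hy).2)
    have h2 := h1.trans (hb k)
    rw [Real.div_rpow hT hT'0.le, le_div_iff₀ (by positivity)]
    rw [← div_eq_mul_inv, le_div_iff₀ hs] at h2
    linarith
  have hlim : Filter.Tendsto (fun k : ℕ => (T / T') ^ (χ ^ k)) Filter.atTop (nhds 0) := by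
    have hq : T / T' < 1 := by rw [div_lt_one hT'0]; exact hT1
    have h1 : Filter.Tendsto (fun k : ℕ => χ ^ k) Filter.atTop Filter.atTop :=
      tendsto_pow_atTop_atTop_of_one_lt hχ
    have hq0 : 0 ≤ T / T' := by positivity
    exact (tendsto_rpow_atTop_of_base_lt_one (T / T') (by linarith) hq).comp h1
  have := ge_of_tendsto' hlim hk
  nlinarith [mul_pos hmpos hs]

theorem moser_sup (n : ℕ) (hn : 2 ≤ n) {Λ : ℝ} (hΛ : 1 ≤ Λ) : ∃ s : ℝ, 0 < s ∧
    ∀ A : EE n → DD n →L[ℝ] DD n →L[ℝ] ℝ, Ell n Λ A → ∀ g : EE n → ℝ, ContDiff ℝ 1 g →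
    (∀ x, 1 ≤ g x) → SubSol A g g → ∀ x ∈ ball (0 : EE n) (1/4),
      g x ^ 2 ≤ s * ∫ x in closedBall (0 : EE n) (1/2), g x ^ 2 := by
  obtain ⟨CS, hCS, sob⟩ := sobolev_real n hn
  obtain ⟨L, hL, hcut⟩ := exists_cutoff
  have hn1 : (2:ℝ) ≤ n := by exact_mod_cast hn
  set χ : ℝ := (n:ℝ) / (n - 1) with hχ
  have hχ1 : 1 < χ := by rw [hχ, lt_div_iff₀ (by linarith)]; linarith
  have hχ2 : χ ≤ 2 := by rw [hχ, div_le_iff₀ (by linarith)]; linarith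
  set C := CS * (768 * Λ ^ 2 * L ^ 2) with hC
  have hC1 : 1 ≤ C := by
    have h1 : 1 ≤ Λ ^ 2 := by nlinarith
    have h2 : 1 ≤ L ^ 2 := by nlinarith
    have h3 : 1 ≤ Λ ^ 2 * L ^ 2 := by nlinarith
    rw [hC]; nlinarith
  obtain ⟨s, hs, hit⟩ := moser_iter χ C 8 hχ1 hC1 (by norm_num)
  refine ⟨s, hs, fun A hA g hg g1 hsol => ?_⟩
  have gpos : ∀ x, 0 < g x := fun x => by linarith [g1 x]
  set r : ℕ → ℝ := fun k => 1/4 + (1/4) * (1/2) ^ k with hr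
  set I : ℕ → ℝ := fun k => ∫ x in closedBall (0 : EE n) (r k), g x ^ (2 * χ ^ k) with hI
  have hI0 : ∀ k, 0 ≤ I k := fun k => integral_nonneg fun x => Real.rpow_nonneg (gpos x).le _
  have hstep : ∀ k, I (k+1) ≤ (C * 8 ^ k * I k) ^ χ := by
    intro k
    have hp : (0:ℝ) < (1/2) ^ k := by positivity
    have hp1 : ((1/2 : ℝ)) ^ k ≤ 1 := pow_le_one₀ (by norm_num) (by norm_num)
    have hrr : r k - r (k+1) = (1/8) * (1/2) ^ k := by simp only [hr, pow_succ]; ring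
    obtain ⟨η, e1, e2, e3, e4, e5, e6, e7⟩ := hcut n (r (k+1)) (r k)
      (by simp only [hr]; positivity) (by have : 0 < r k - r (k+1) := by rw [hrr]; positivity
                                          linarith)
    have hN : L / (r k - r (k+1)) = 8 * L * 2 ^ k := by
      rw [hrr, one_div_pow]; field_simp
    rw [hN] at e7
    have h2k : (1:ℝ) ≤ 2 ^ k := one_le_pow₀ (by norm_num)
    have hst := moser_step hΛ hA hCS hχ1.le sob hg g1 hsol (e1.of_le (by exact_mod_cast le_top)) e2 e3
      (r := r k) (r' := r (k+1)) (by simp only [hr]; linarith) e4 e5 e6 (N := 8 * L * 2 ^ k)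
      (by nlinarith) e7 (q := 2 * χ ^ k) (by have : 1 ≤ χ ^ k := one_le_pow₀ hχ1.le
                                             linarith)
    have hexp : 2 * χ ^ k * χ = 2 * χ ^ (k+1) := by rw [pow_succ]; ring
    rw [hexp] at hst
    refine hst.trans ?_
    have hIk := hI0 k
    apply Real.rpow_le_rpow _ _ (by linarith)
    · have : 0 ≤ χ ^ k := by positivity
      change 0 ≤ CS * (6 * Λ ^ 2 * (8 * L * 2 ^ k) ^ 2 * (2 * χ ^ k)) * I k
      positivity
    · change CS * (6 * Λ ^ 2 * (8 * L * 2 ^ k) ^ 2 * (2 * χ ^ k)) * I k ≤ C * 8 ^ k * I k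
      apply mul_le_mul_of_nonneg_right _ hIk
      have hχk : χ ^ k ≤ 2 ^ k := by gcongr
      have h8 : (8:ℝ) ^ k = 2 ^ k * 2 ^ k * 2 ^ k := by rw [← mul_pow, ← mul_pow]; norm_num
      rw [hC, h8]
      calc CS * (6 * Λ ^ 2 * (8 * L * 2 ^ k) ^ 2 * (2 * χ ^ k))
          ≤ CS * (6 * Λ ^ 2 * (8 * L * 2 ^ k) ^ 2 * (2 * 2 ^ k)) := by gcongr
        _ = _ := by ring
  have hb := hit I hI0 hstep
  have hIe : I 0 = ∫ x in closedBall (0 : EE n) (1/2), g x ^ 2 := by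
    simp only [hI, hr]
    norm_num
  rw [← hIe]
  exact sup_of_powers hg.continuous g1 hχ1 (mul_nonneg hs.le (hI0 0)) hs
    (fun k => by simp only [hr]; have : (0:ℝ) < (1/2) ^ k := by positivity
                 linarith) (fun k => rfl) hb

theorem log_cacc (n : ℕ) {Λ : ℝ} (hΛ : 1 ≤ Λ) : ∃ C : ℝ, 0 ≤ C ∧
    ∀ A : EE n → DD n →L[ℝ] DD n →L[ℝ] ℝ, Ell n Λ A → ∀ v : EE n → ℝ, ContDiff ℝ 1 v →
    SubSol A v (fun x => 1 - A x (fderiv ℝ v x) (fderiv ℝ v x)) →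
    ∫ x in ball (0 : EE n) (3/4), ‖fderiv ℝ v x‖ ^ 2 ≤ C := by
  obtain ⟨L, hL, hcut⟩ := exists_cutoff
  obtain ⟨η, e1, e2, e3, e4, e5, e6, e7⟩ := hcut n (3/4) (7/8) (by norm_num) (by norm_num)
  have hη1 : ContDiff ℝ 1 η := e1.of_le (by exact_mod_cast le_top)
  set K := (∫ x, η x ^ 2) + 2 * (Λ * ∫ x, ‖fderiv ℝ η x‖ ^ 2) with hK
  have hK0 : 0 ≤ K := by
    have h1 : 0 ≤ ∫ x, η x ^ 2 := integral_nonneg fun x => sq_nonneg _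
    have h2 : 0 ≤ ∫ x, ‖fderiv ℝ η x‖ ^ 2 := integral_nonneg fun x => sq_nonneg _
    positivity
  refine ⟨2 * Λ * K, by positivity, fun A hA v hv hs => ?_⟩
  have cη := hη1.continuous
  have cηd := cont_fd hη1
  have cvd := cont_fd hv
  set ψ : EE n → ℝ := fun x => η x ^ 2 with hψ
  have hψ1 : ContDiff ℝ 1 ψ := hη1.pow 2
  have hψs : tsupport ψ ⊆ tsupport η := by
    have : ψ = fun x => η x * η x := by ext x; simp only [hψ]; ring
    rw [this]
    exact tsupport_mul_subset_left
  have hψc : HasCompactSupport ψ := e6.of_isClosed_subset (isClosed_tsupport _) hψs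
  have hsol := hs ψ ⟨hψ1, hψc, hψs.trans (e5.trans (closedBall_subset_ball (by norm_num)))⟩
    (fun x => sq_nonneg _)
  have cvv := cont_A hA cvd cvd
  have i1 : Integrable (fun x => A x (fderiv ℝ v x) (fderiv ℝ ψ x)) :=
    integrable_of_zero (cont_A hA cvd (cont_fd hψ1)) hψc (fun x hx => by simp [test_fzero hx])
  have i2 : Integrable (fun x => A x (fderiv ℝ η x) (fderiv ℝ η x)) :=
    integrable_of_zero (cont_A hA cηd cηd) e6 (fun x hx => by simp [test_fzero hx])
  have i2' : Integrable (fun x => ‖fderiv ℝ η x‖ ^ 2) :=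
    integrable_of_zero (cηd.norm.pow 2) e6 (fun x hx => by simp [test_fzero hx])
  have i3 : Integrable (fun x => η x ^ 2) :=
    integrable_of_zero (cη.pow 2) e6 (fun x hx => by simp [test_zero hx])
  have i4 : Integrable (fun x => η x ^ 2 * A x (fderiv ℝ v x) (fderiv ℝ v x)) :=
    integrable_of_zero ((cη.pow 2).mul cvv) e6 (fun x hx => by simp [test_zero hx])
  have i5 : Integrable (fun x => η x ^ 2 * ‖fderiv ℝ v x‖ ^ 2) :=
    integrable_of_zero ((cη.pow 2).mul (cvd.norm.pow 2)) e6 (fun x hx => by simp [test_zero hx])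
  have hR : ∫ x, (1 - A x (fderiv ℝ v x) (fderiv ℝ v x)) * ψ x
      = (∫ x, η x ^ 2) - ∫ x, η x ^ 2 * A x (fderiv ℝ v x) (fderiv ℝ v x) := by
    rw [← integral_sub i3 i4]; congr 1; ext x; simp only [hψ]; ring
  have hintg : -(1/2) * (∫ x, η x ^ 2 * A x (fderiv ℝ v x) (fderiv ℝ v x))
      - 2 * ∫ x, A x (fderiv ℝ η x) (fderiv ℝ η x) ≤ ∫ x, A x (fderiv ℝ v x) (fderiv ℝ ψ x) := by
    rw [← integral_const_mul, ← integral_const_mul, ← integral_sub (i4.const_mul _) (i2.const_mul 2)]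
    apply integral_mono ((i4.const_mul _).sub (i2.const_mul 2)) i1
    intro x
    change -(1/2) * (η x ^ 2 * A x (fderiv ℝ v x) (fderiv ℝ v x))
      - 2 * A x (fderiv ℝ η x) (fderiv ℝ η x) ≤ A x (fderiv ℝ v x) (fderiv ℝ ψ x)
    have hy := hA.young hΛ x (η x • fderiv ℝ v x) (fderiv ℝ η x)
    simp only [map_smul, smul_apply, smul_eq_mul] at hy
    have hD : fderiv ℝ ψ x = (2 * η x) • fderiv ℝ η x := by
      have h2 : HasFDerivAt η (fderiv ℝ η x) x := (hη1.differentiable (by norm_num) x).hasFDerivAt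
      have e : fderiv ℝ ψ x = _ := (h2.pow 2).fderiv
      rw [e]; simp
    rw [hD]
    simp only [map_smul, smul_eq_mul]
    linarith
  have hup : ∫ x, A x (fderiv ℝ η x) (fderiv ℝ η x) ≤ Λ * ∫ x, ‖fderiv ℝ η x‖ ^ 2 := by
    rw [← integral_const_mul]
    exact integral_mono i2 (i2'.const_mul _) (fun x => hA.upper x _)
  have hlow : Λ⁻¹ * ∫ x, η x ^ 2 * ‖fderiv ℝ v x‖ ^ 2
      ≤ ∫ x, η x ^ 2 * A x (fderiv ℝ v x) (fderiv ℝ v x) := by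
    rw [← integral_const_mul]
    apply integral_mono (i5.const_mul _) i4
    intro x
    have := mul_le_mul_of_nonneg_left (hA.lower x (fderiv ℝ v x)) (sq_nonneg (η x))
    simp only
    linarith
  have hfin : Λ⁻¹ * ∫ x, η x ^ 2 * ‖fderiv ℝ v x‖ ^ 2 ≤ 2 * K := by
    rw [hR] at hsol
    linarith
  rw [inv_mul_le_iff₀ (by linarith)] at hfin
  calc ∫ x in ball (0 : EE n) (3/4), ‖fderiv ℝ v x‖ ^ 2
      = ∫ x in ball (0 : EE n) (3/4), η x ^ 2 * ‖fderiv ℝ v x‖ ^ 2 := by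
        apply setIntegral_congr_fun measurableSet_ball
        intro x hx
        simp [e4 x (ball_subset_closedBall hx)]
    _ ≤ ∫ x, η x ^ 2 * ‖fderiv ℝ v x‖ ^ 2 :=
        setIntegral_le_integral i5 (Filter.Eventually.of_forall fun x => by positivity)
    _ ≤ _ := by linarith

theorem growth_v (n : ℕ) (hn : 2 ≤ n) {Λ : ℝ} (hΛ : 1 ≤ Λ) : ∃ K : ℝ, 0 ≤ K ∧
    ∀ A : EE n → DD n →L[ℝ] DD n →L[ℝ] ℝ, Ell n Λ A → ∀ v : EE n → ℝ, ContDiff ℝ 1 v →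
    SubSol A v (fun x => 1 - A x (fderiv ℝ v x) (fderiv ℝ v x)) →
    ∀ Z : Set (EE n), MeasurableSet Z → Z ⊆ ball 0 (3/4) → (∀ x ∈ Z, v x ≤ 0) →
    volume (ball (0 : EE n) (3/4)) ≤ 2 * volume Z → ∀ x ∈ ball (0 : EE n) (1/4), v x ≤ K := by
  obtain ⟨s, hs, hmos⟩ := moser_sup n hn hΛ
  obtain ⟨C, hC, hlog⟩ := log_cacc n hΛ
  set V := (volume : Measure (EE n)).real (closedBall (0 : EE n) (1/2)) with hV
  have hV0 : 0 ≤ V := measureReal_nonneg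
  set Q := s * (8 * V + 2 * (8 * 2 ^ n * C)) with hQ
  refine ⟨√Q, Real.sqrt_nonneg _, fun A hA v hv hsv Z hZm hZs hZ0 hZv => ?_⟩
  have cv := hv.continuous
  have cdv := cont_fd hv
  have cvv := cont_A hA cdv cdv
  set g : EE n → ℝ := fun x => 1 + log (1 + exp (v x)) with hg
  set h : EE n → ℝ := fun x => exp (v x) / (1 + exp (v x)) with hh
  set k : EE n → ℝ := fun x => exp (v x) / (1 + exp (v x)) ^ 2 with hk
  have hpos : ∀ x, 0 < 1 + exp (v x) := fun x => by positivity
  have hE : ContDiff ℝ 1 (fun x => 1 + exp (v x)) := contDiff_const.add hv.exp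
  have hg1 : ContDiff ℝ 1 g := contDiff_const.add (hE.log fun x => (hpos x).ne')
  have hh1 : ContDiff ℝ 1 h := hv.exp.div hE fun x => (hpos x).ne'
  have hkc : Continuous k := (hv.exp.continuous).div (hE.continuous.pow 2) fun x => (pow_pos (hpos x) 2).ne'
  have hdv : ∀ x, HasFDerivAt v (fderiv ℝ v x) x := fun x =>
    (hv.differentiable (by norm_num) x).hasFDerivAt
  have dg : ∀ x, fderiv ℝ g x = h x • fderiv ℝ v x := by
    intro x
    have h1 : HasDerivAt (fun t : ℝ => 1 + log (1 + exp t)) (h x) (v x) := by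
      have := (((Real.hasDerivAt_exp (v x)).const_add 1).log (hpos x).ne').const_add 1
      exact this
    exact (h1.comp_hasFDerivAt x (hdv x)).fderiv
  have dh : ∀ x, fderiv ℝ h x = k x • fderiv ℝ v x := by
    intro x
    have h1 : HasDerivAt (fun t : ℝ => exp t / (1 + exp t)) (k x) (v x) := by
      have := (Real.hasDerivAt_exp (v x)).div ((Real.hasDerivAt_exp (v x)).const_add 1) (hpos x).ne'
      refine this.congr_deriv ?_
      simp only [hk]; congr 1; ring
    exact (h1.comp_hasFDerivAt x (hdv x)).fderiv
  have g1 : ∀ x, 1 ≤ g x := fun x => by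
    have : 0 ≤ log (1 + exp (v x)) := Real.log_nonneg (by linarith [exp_pos (v x)])
    simp only [hg]; linarith
  have hcb : Continuous (fun x => 1 - A x (fderiv ℝ v x) (fderiv ℝ v x)) := continuous_const.sub cvv
  have hsg : SubSol A g g := by
    refine (SubSol.comp hA hsv hv hcb hh1 (fun x => by positivity) hkc dg dh).mono
      ((hh1.continuous.mul hcb).sub (hkc.mul cvv)) hg1.continuous (fun x => ?_)
    have hAn := hA.nonneg hΛ x (fderiv ℝ v x)
    have hh0 : 0 ≤ h x := by positivity
    have hk0 : 0 ≤ k x := by positivity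
    have hh1 : h x ≤ 1 := by
      simp only [hh]; rw [div_le_one (hpos x)]; linarith
    nlinarith [g1 x, mul_nonneg hh0 hAn, mul_nonneg hk0 hAn]
  have hmain := hmos A hA g hg1 g1 hsg
  have hpo := poincare hv (ρ := 3/4) (by norm_num) (by norm_num) hZm hZs hZ0 hZv
  have hlg := hlog A hA v hv hsv
  have cm : Continuous (fun x => (max (v x) 0) ^ 2) := (cv.max continuous_const).pow 2
  have im : IntegrableOn (fun x => (max (v x) 0) ^ 2) (closedBall 0 (3/4)) :=
    cm.continuousOn.integrableOn_compact (isCompact_closedBall _ _)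
  have idv : IntegrableOn (fun x => ‖fderiv ℝ v x‖ ^ 2) (closedBall 0 (3/4)) :=
    (cdv.norm.pow 2).continuousOn.integrableOn_compact (isCompact_closedBall _ _)
  rw [← ofReal_integral_eq_lintegral_ofReal (im.mono_set ball_subset_closedBall)
      (Filter.Eventually.of_forall fun x => sq_nonneg _),
    ← ofReal_integral_eq_lintegral_ofReal (idv.mono_set ball_subset_closedBall)
      (Filter.Eventually.of_forall fun x => sq_nonneg _)] at hpo
  have e8 : (8 : ENNReal) * ENNReal.ofReal (2 ^ n) = ENNReal.ofReal (8 * 2 ^ n) := by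
    rw [ENNReal.ofReal_mul (by norm_num)]; norm_num
  rw [e8, ← ENNReal.ofReal_mul (by positivity)] at hpo
  have hint0 : 0 ≤ ∫ x in ball (0 : EE n) (3/4), ‖fderiv ℝ v x‖ ^ 2 :=
    integral_nonneg fun x => sq_nonneg _
  rw [ENNReal.ofReal_le_ofReal_iff (by positivity)] at hpo
  have hm2 : ∫ x in closedBall (0 : EE n) (1/2), (max (v x) 0) ^ 2 ≤ 8 * 2 ^ n * C := by
    calc ∫ x in closedBall (0 : EE n) (1/2), (max (v x) 0) ^ 2
        ≤ ∫ x in ball (0 : EE n) (3/4), (max (v x) 0) ^ 2 := by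
          apply setIntegral_mono_set (im.mono_set ball_subset_closedBall)
          · exact Filter.Eventually.of_forall fun x => sq_nonneg _
          · exact LE.le.eventuallyLE (closedBall_subset_ball (by norm_num))
      _ ≤ 8 * 2 ^ n * ∫ x in ball (0 : EE n) (3/4), ‖fderiv ℝ v x‖ ^ 2 := hpo
      _ ≤ _ := by gcongr
  have hgv : ∀ x, g x ^ 2 ≤ 8 + 2 * (max (v x) 0) ^ 2 := by
    intro x
    have hm0 : 0 ≤ max (v x) 0 := le_max_right _ _
    have h1 : log (1 + exp (v x)) ≤ 1 + max (v x) 0 := by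
      rw [Real.log_le_iff_le_exp (hpos x), Real.exp_add]
      have a1 : exp (v x) ≤ exp (max (v x) 0) := exp_le_exp.2 (le_max_left _ _)
      have a2 : 1 ≤ exp (max (v x) 0) := one_le_exp hm0
      have a3 : 2 ≤ exp 1 := by have := Real.add_one_le_exp (1:ℝ); linarith
      nlinarith
    have h2 : g x ≤ 2 + max (v x) 0 := by simp only [hg]; linarith
    have h3 := g1 x
    nlinarith [sq_nonneg (2 - max (v x) 0)]
  have hgi : ∫ x in closedBall (0 : EE n) (1/2), g x ^ 2 ≤ 8 * V + 2 * (8 * 2 ^ n * C) := by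
    have icm : IntegrableOn (fun x => (max (v x) 0) ^ 2) (closedBall (0 : EE n) (1/2)) :=
      cm.continuousOn.integrableOn_compact (isCompact_closedBall _ _)
    have ic : IntegrableOn (fun _ : EE n => (8:ℝ)) (closedBall (0 : EE n) (1/2)) :=
      integrableOn_const (isCompact_closedBall _ _).measure_lt_top.ne
    calc ∫ x in closedBall (0 : EE n) (1/2), g x ^ 2
        ≤ ∫ x in closedBall (0 : EE n) (1/2), (8 + 2 * (max (v x) 0) ^ 2) := by
          apply integral_mono
          · exact (hg1.continuous.pow 2).continuousOn.integrableOn_compact (isCompact_closedBall _ _)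
          · exact ic.add (icm.const_mul 2)
          · exact hgv
      _ = 8 * V + 2 * ∫ x in closedBall (0 : EE n) (1/2), (max (v x) 0) ^ 2 := by
          rw [integral_add ic (icm.const_mul 2), integral_const_mul, setIntegral_const]
          simp [hV, mul_comm]
      _ ≤ _ := by linarith
  intro x hx
  have h1 : g x ^ 2 ≤ Q := (hmain x hx).trans (mul_le_mul_of_nonneg_left hgi hs.le)
  have h2 : g x ≤ √Q := Real.le_sqrt_of_sq_le h1
  have h3 : v x ≤ log (1 + exp (v x)) := by
    rw [Real.le_log_iff_exp_le (hpos x)]; linarith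
  have : g x = 1 + log (1 + exp (v x)) := rfl
  linarith

theorem growth (n : ℕ) (hn : 2 ≤ n) {Λ : ℝ} (hΛ : 1 ≤ Λ) : ∃ c : ℝ, 0 < c ∧ c ≤ 1/2 ∧
    ∀ A : EE n → DD n →L[ℝ] DD n →L[ℝ] ℝ, Ell n Λ A → ∀ u : EE n → ℝ, ContDiff ℝ 1 u →
    ∀ μ : ℝ, 0 < μ → (∀ x, u x ≤ 0) →
    SubSol A u (fun x => 2 * ‖fderiv ℝ u x‖ ^ 2 + μ) → ∀ d : ℝ, 0 < d →
    volume (ball (0 : EE n) (3/4)) ≤ 2 * volume ({x | u x ≤ -d} ∩ ball (0 : EE n) (3/4)) →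
    ∀ x ∈ ball (0 : EE n) (1/4), u x ≤ -(c * (1 - exp (-(2 * Λ * d)))) + μ := by
  obtain ⟨K, hK, hgr⟩ := growth_v n hn hΛ
  refine ⟨exp (-K) / (2 * Λ), by positivity, ?_, fun A hA u hu μ hμ hu0 hsu d hd hvol => ?_⟩
  · have : exp (-K) ≤ 1 := exp_le_one_iff.2 (by linarith)
    rw [div_le_div_iff₀ (by positivity) (by norm_num)]; linarith
  have hΛ0 : 0 < Λ := by linarith
  set s := 2 * Λ * μ with hs
  have hs0 : 0 < s := by positivity
  set h0 := 1 - exp (-(2 * Λ * d)) with hh0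
  have hh0p : 0 < h0 := by
    have : exp (-(2 * Λ * d)) < 1 := exp_lt_one_iff.2 (by nlinarith [mul_pos hΛ0 hd])
    linarith
  set E : EE n → ℝ := fun x => exp (2 * Λ * u x) with hE
  have hE1 : ∀ x, E x ≤ 1 := fun x => exp_le_one_iff.2 (by nlinarith [hu0 x])
  have hE0 : ∀ x, 0 < E x := fun x => exp_pos _
  set z : EE n → ℝ := fun x => 1 + s - E x with hz
  have hzs : ∀ x, s ≤ z x := fun x => by simp only [hz]; linarith [hE1 x]
  have hz0 : ∀ x, 0 < z x := fun x => hs0.trans_le (hzs x)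
  set v : EE n → ℝ := fun x => log h0 - log (z x) with hv
  set h : EE n → ℝ := fun x => 2 * Λ * E x / z x with hh
  set k : EE n → ℝ := fun x => 2 * Λ * h x + h x ^ 2 with hk
  have hE' : ContDiff ℝ 1 E := (contDiff_const.mul hu).exp
  have hz' : ContDiff ℝ 1 z := contDiff_const.sub hE'
  have hv' : ContDiff ℝ 1 v := contDiff_const.sub (hz'.log fun x => (hz0 x).ne')
  have hh' : ContDiff ℝ 1 h := (contDiff_const.mul hE').div hz' fun x => (hz0 x).ne'
  have hkc : Continuous k := (continuous_const.mul hh'.continuous).add (hh'.continuous.pow 2)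
  have hdu : ∀ x, HasFDerivAt u (fderiv ℝ u x) x := fun x =>
    (hu.differentiable (by norm_num) x).hasFDerivAt
  have hhp : ∀ x, 0 ≤ h x := fun x => by
    have := hz0 x; have := hE0 x; simp only [hh]; positivity
  have d1 : ∀ x, HasDerivAt (fun t : ℝ => exp (2 * Λ * t)) (E x * (2 * Λ)) (u x) := by
    intro x
    have := ((hasDerivAt_id (u x)).const_mul (2 * Λ)).exp
    simpa using this
  have dv : ∀ x, fderiv ℝ v x = h x • fderiv ℝ u x := by
    intro x
    have h1 : HasDerivAt (fun t : ℝ => log h0 - log (1 + s - exp (2 * Λ * t))) (h x) (u x) := by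
      have := (((d1 x).const_sub (1 + s)).log (hz0 x).ne').const_sub (log h0)
      refine this.congr_deriv ?_
      change -(-(E x * (2 * Λ)) / z x) = 2 * Λ * E x / z x
      ring
    exact (h1.comp_hasFDerivAt x (hdu x)).fderiv
  have dh : ∀ x, fderiv ℝ h x = k x • fderiv ℝ u x := by
    intro x
    have h1 : HasDerivAt (fun t : ℝ => 2 * Λ * exp (2 * Λ * t) / (1 + s - exp (2 * Λ * t))) (k x) (u x) := by
      have := ((d1 x).const_mul (2 * Λ)).div ((d1 x).const_sub (1 + s)) (hz0 x).ne'
      refine this.congr_deriv ?_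
      change (2 * Λ * (E x * (2 * Λ)) * z x - 2 * Λ * E x * -(E x * (2 * Λ))) / z x ^ 2 = k x
      simp only [hk, hh]
      have := (hz0 x).ne'
      field_simp
      ring
    exact (h1.comp_hasFDerivAt x (hdu x)).fderiv
  have cdu := cont_fd hu
  have cuu := cont_A hA cdu cdu
  have cdv := cont_fd hv'
  have hcb : Continuous (fun x => 2 * ‖fderiv ℝ u x‖ ^ 2 + μ) :=
    (continuous_const.mul (cdu.norm.pow 2)).add continuous_const
  have hsv : SubSol A v (fun x => 1 - A x (fderiv ℝ v x) (fderiv ℝ v x)) := by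
    refine (SubSol.comp hA hsu hu hcb hh' hhp hkc dv dh).mono
      ((hh'.continuous.mul hcb).sub (hkc.mul cuu)) (continuous_const.sub (cont_A hA cdv cdv))
      (fun x => ?_)
    simp only [dv, map_smul, smul_apply, smul_eq_mul, hk]
    have hl := hA.lower x (fderiv ℝ u x)
    rw [inv_mul_le_iff₀ hΛ0] at hl
    have hm : h x * μ ≤ 1 := by
      simp only [hh]
      rw [div_mul_eq_mul_div, div_le_one (hz0 x)]
      refine le_trans ?_ (hzs x)
      rw [hs]
      have : 0 < 2 * Λ * μ := by positivity
      nlinarith [hE1 x]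
    nlinarith [mul_le_mul_of_nonneg_left hl (hhp x)]
  intro x hx
  have hvx := hgr A hA v hv' hsv ({x | u x ≤ -d} ∩ ball (0 : EE n) (3/4))
    ((isClosed_le hu.continuous continuous_const).measurableSet.inter measurableSet_ball)
    inter_subset_right (fun y hy => ?_) hvol x hx
  · have h1 : log (h0 * exp (-K)) ≤ log (z x) := by
      rw [Real.log_mul hh0p.ne' (exp_pos _).ne', Real.log_exp]
      have : v x = log h0 - log (z x) := rfl
      linarith
    rw [Real.log_le_log_iff (by positivity) (hz0 x)] at h1
    have h2 : 1 + 2 * Λ * u x ≤ E x := by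
      have := Real.add_one_le_exp (2 * Λ * u x); simp only [hE]; linarith
    have h3 : z x = 1 + s - E x := rfl
    have h4 : 2 * Λ * u x ≤ 2 * Λ * μ - h0 * exp (-K) := by linarith
    have h5 : 2 * Λ * (exp (-K) / (2 * Λ) * h0) = h0 * exp (-K) := by field_simp
    have : 2 * Λ * u x ≤ 2 * Λ * (-(exp (-K) / (2 * Λ) * h0) + μ) := by linarith
    exact le_of_mul_le_mul_left this (by positivity)
  · have hy1 : u y ≤ -d := hy.1
    have : E y ≤ exp (-(2 * Λ * d)) := exp_le_exp.2 (by nlinarith)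
    have h3 : h0 ≤ z y := by simp only [hz, hh0]; linarith
    have := Real.log_le_log hh0p h3
    simp only [hv]; linarith

theorem exists_norm_bound {n : ℕ} {F : Type*} [NormedAddCommGroup F] {g : EE n → F}
    (hg : Continuous g) (hc : HasCompactSupport g) : ∃ M : ℝ, ∀ x, ‖g x‖ ≤ M := by
  obtain ⟨M, hM⟩ := hg.bounded_above_of_compact_support hc
  exact ⟨M, hM⟩

open scoped Convolution in
theorem mollify {n : ℕ} {ψ : EE n → ℝ} (hψ : IsTest ψ) : ∃ r < 1, ∃ M : ℝ,
    ∃ Ψ : ℕ → EE n → ℝ, (∀ k, ContDiff ℝ (⊤ : ℕ∞) (Ψ k)) ∧ (∀ k, tsupport (Ψ k) ⊆ closedBall 0 r) ∧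
      (∀ k x, |Ψ k x| ≤ M) ∧ (∀ k x, ‖fderiv ℝ (Ψ k) x‖ ≤ M) ∧
      (∀ x, Filter.Tendsto (fun k => Ψ k x) Filter.atTop (nhds (ψ x))) ∧
      (∀ x, Filter.Tendsto (fun k => fderiv ℝ (Ψ k) x) Filter.atTop (nhds (fderiv ℝ ψ x))) := by
  obtain ⟨hc, hcs, hsub⟩ := hψ
  have hr0 : ∃ r0 < 1, tsupport ψ ⊆ closedBall 0 r0 := by
    rcases (tsupport ψ).eq_empty_or_nonempty with he | hne
    · exact ⟨0, by norm_num, by simp [he]⟩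
    · obtain ⟨y, hy, hmax⟩ := hcs.isCompact.exists_isMaxOn hne continuous_norm.continuousOn
      refine ⟨‖y‖, by simpa using hsub hy, fun z hz => ?_⟩
      simpa using hmax hz
  obtain ⟨r0, hr0, hs0⟩ := hr0
  set ε := (1 - r0) / 2 with hε
  have hε0 : 0 < ε := by rw [hε]; linarith
  obtain ⟨M1, hM1⟩ := exists_norm_bound hc.continuous hcs
  have hDc := cont_fd hc
  obtain ⟨M2, hM2⟩ := exists_norm_bound hDc (hcs.fderiv ℝ)
  let φ : ℕ → ContDiffBump (0 : EE n) := fun k =>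
    { rIn := ε / 2 * (1/2) ^ k, rOut := ε * (1/2) ^ k, rIn_pos := by positivity
      rIn_lt_rOut := by
        have : (0:ℝ) < (1/2) ^ k := by positivity
        nlinarith }
  have hrout : ∀ k, (φ k).rOut = ε * (1/2) ^ k := fun k => rfl
  have hrl : ∀ k, (φ k).rOut ≤ ε := fun k => by
    rw [hrout]
    have : ((1/2 : ℝ)) ^ k ≤ 1 := pow_le_one₀ (by norm_num) (by norm_num)
    nlinarith
  have hrt : Filter.Tendsto (fun k => (φ k).rOut) Filter.atTop (nhds 0) := by
    simp only [hrout]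
    have := (tendsto_pow_atTop_nhds_zero_of_lt_one (r := (1/2:ℝ)) (by norm_num) (by norm_num)).const_mul ε
    simpa using this
  set Ψ : ℕ → EE n → ℝ := fun k => ((φ k).normed volume ⋆[ContinuousLinearMap.lsmul ℝ ℝ, volume] ψ) with hΨ
  have hloc : ∀ k, LocallyIntegrable ((φ k).normed volume) (volume : Measure (EE n)) := fun k =>
    (φ k).continuous_normed.locallyIntegrable
  have hD : ∀ k x, fderiv ℝ (Ψ k) x
      = ((φ k).normed volume ⋆[ContinuousLinearMap.lsmul ℝ ℝ, volume] (fderiv ℝ ψ)) x := by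
    intro k x
    have := (hcs.hasFDerivAt_convolution_right (ContinuousLinearMap.lsmul ℝ ℝ) (hloc k) hc x).fderiv
    rw [hΨ]
    rw [this]
    simp only [convolution]
    congr 1
  have bd : ∀ {F : Type} [NormedAddCommGroup F] [NormedSpace ℝ F] [CompleteSpace F] (g : EE n → F) (M : ℝ), Continuous g →
      (∀ x, ‖g x‖ ≤ M) → ∀ k x,
      ‖((φ k).normed volume ⋆[ContinuousLinearMap.lsmul ℝ ℝ, volume] g) x‖ ≤ 3 * M := by
    intro F _ _ _ g M hg hM k x
    have h1 := (φ k).dist_normed_convolution_le (μ := volume) (g := g) (x₀ := x) (ε := 2 * M)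
      hg.aestronglyMeasurable (fun y hy => by
        rw [dist_eq_norm]; linarith [norm_sub_le (g y) (g x), hM x, hM y])
    rw [dist_eq_norm] at h1
    have h2 := norm_le_norm_add_norm_sub' (((φ k).normed volume ⋆[ContinuousLinearMap.lsmul ℝ ℝ, volume] g) x) (g x)
    linarith [hM x]
  refine ⟨r0 + ε, by rw [hε]; linarith, max (3 * M1) (3 * M2), Ψ, ?_, ?_, ?_, ?_, ?_, ?_⟩
  · intro k
    exact (φ k).hasCompactSupport_normed.contDiff_convolution_left _ (φ k).contDiff_normed
      hc.continuous.locallyIntegrable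
  · intro k
    apply closure_minimal _ isClosed_closedBall
    refine (support_convolution_subset _).trans ?_
    rw [(φ k).support_normed_eq]
    rintro _ ⟨a, ha, b, hb, rfl⟩
    have h1 : ‖a‖ < (φ k).rOut := by simpa using ha
    have h2 : ‖b‖ ≤ r0 := by simpa using hs0 (subset_tsupport _ hb)
    have := hrl k
    have h3 := norm_add_le a b
    simp only [mem_closedBall, dist_zero_right]
    linarith
  · intro k x
    exact (bd ψ M1 hc.continuous hM1 k x).trans (le_max_left _ _)
  · intro k x
    rw [hD]
    exact (bd (fderiv ℝ ψ) M2 hDc hM2 k x).trans (le_max_right _ _)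
  · intro x
    exact ContDiffBump.convolution_tendsto_right_of_continuous hrt hc.continuous x
  · intro x
    simp only [hD]
    exact ContDiffBump.convolution_tendsto_right_of_continuous hrt hDc x

theorem weak_C1 {n : ℕ} {G : EE n → DD n →L[ℝ] ℝ} {H : EE n → ℝ}
    (hG : ContinuousOn G (ball 0 1)) (hH : ContinuousOn H (ball 0 1))
    (hw : ∀ ψ : EE n → ℝ, ContDiff ℝ (⊤ : ℕ∞) ψ → HasCompactSupport ψ → tsupport ψ ⊆ ball 0 1 →
      ∫ x in ball (0 : EE n) 1, G x (fderiv ℝ ψ x) = ∫ x in ball (0 : EE n) 1, H x * ψ x)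
    {ψ : EE n → ℝ} (hψ : IsTest ψ) : ∫ x, G x (fderiv ℝ ψ x) = ∫ x, H x * ψ x := by
  obtain ⟨r, hr, M, Ψ, h1, h2, h3, h4, h5, h6⟩ := mollify hψ
  have hsub : closedBall (0 : EE n) r ⊆ ball 0 1 := closedBall_subset_ball hr
  have hid : ∀ k, ∫ x in ball (0 : EE n) 1, G x (fderiv ℝ (Ψ k) x) = ∫ x in ball (0 : EE n) 1, H x * Ψ k x :=
    fun k => hw _ (h1 k) ((isCompact_closedBall 0 r).of_isClosed_subset (isClosed_tsupport _) (h2 k)) ((h2 k).trans hsub)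
  have hM : 0 ≤ M := (abs_nonneg _).trans (h3 0 0)
  have iG : Integrable ((closedBall (0 : EE n) r).indicator (fun x => ‖G x‖ * M)) :=
    (((hG.mono hsub).norm.mul continuousOn_const).integrableOn_compact
      (isCompact_closedBall 0 r)).integrable_indicator measurableSet_closedBall
  have iH : Integrable ((closedBall (0 : EE n) r).indicator (fun x => |H x| * M)) :=
    (((hH.mono hsub).abs.mul continuousOn_const).integrableOn_compact
      (isCompact_closedBall 0 r)).integrable_indicator measurableSet_closedBall
  have t1 : Filter.Tendsto (fun k => ∫ x in ball (0 : EE n) 1, G x (fderiv ℝ (Ψ k) x)) Filter.atTop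
      (nhds (∫ x in ball (0 : EE n) 1, G x (fderiv ℝ ψ x))) := by
    apply tendsto_integral_of_dominated_convergence _ _ iG.integrableOn
    · intro k
      refine Filter.Eventually.of_forall fun x => ?_
      by_cases hx : x ∈ closedBall (0 : EE n) r
      · rw [indicator_of_mem hx]
        exact ((G x).le_opNorm _).trans (mul_le_mul_of_nonneg_left (h4 k x) (norm_nonneg _))
      · rw [indicator_of_notMem hx, test_fzero (fun h => hx (h2 k h))]; simp
    · exact Filter.Eventually.of_forall fun x => ((G x).continuous.tendsto _).comp (h6 x)
    · intro k
      exact (hG.clm_apply (cont_fd ((h1 k).of_le (by exact_mod_cast le_top))).continuousOn).aestronglyMeasurable measurableSet_ball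
  have t2 : Filter.Tendsto (fun k => ∫ x in ball (0 : EE n) 1, H x * Ψ k x) Filter.atTop
      (nhds (∫ x in ball (0 : EE n) 1, H x * ψ x)) := by
    apply tendsto_integral_of_dominated_convergence _ _ iH.integrableOn
    · intro k
      refine Filter.Eventually.of_forall fun x => ?_
      by_cases hx : x ∈ closedBall (0 : EE n) r
      · rw [indicator_of_mem hx, norm_mul]
        exact mul_le_mul_of_nonneg_left (h3 k x) (norm_nonneg _)
      · rw [indicator_of_notMem hx, test_zero (fun h => hx (h2 k h))]; simp
    · exact Filter.Eventually.of_forall fun x => (h5 x).const_mul _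
    · intro k
      exact (hH.mul (h1 k).continuous.continuousOn).aestronglyMeasurable measurableSet_ball
  simp only [hid] at t1
  have := tendsto_nhds_unique t1 t2
  rw [setIntegral_eq_integral_of_forall_compl_eq_zero, setIntegral_eq_integral_of_forall_compl_eq_zero] at this
  · exact this
  · intro x hx; rw [test_zero (fun h => hx (hψ.2.2 h))]; simp
  · intro x hx; rw [test_fzero (fun h => hx (hψ.2.2 h))]; simp

noncomputable def evl {n : ℕ} (i : Fin n) : DD n →L[ℝ] ℝ :=
  ContinuousLinearMap.apply ℝ ℝ (EuclideanSpace.single i (1:ℝ))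

noncomputable def bil {n : ℕ} (w : Fin n → Fin n → ℝ) : DD n →L[ℝ] DD n →L[ℝ] ℝ :=
  ∑ i, ∑ j, w i j • (evl i).smulRight (evl j)

theorem bil_apply {n : ℕ} (w : Fin n → Fin n → ℝ) (p q : DD n) :
    bil w p q = ∑ i, ∑ j, w i j * p (EuclideanSpace.single i 1) * q (EuclideanSpace.single j 1) := by
  simp [bil, evl, mul_assoc]

theorem bil_cont {n : ℕ} {X : Type*} [TopologicalSpace X] {w : X → Fin n → Fin n → ℝ} {s : Set X}
    (hw : ∀ i j, ContinuousOn (fun x => w x i j) s) : ContinuousOn (fun x => bil (w x)) s := by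
  unfold bil
  exact continuousOn_finsetSum _ fun i _ => continuousOn_finsetSum _ fun j _ =>
    (hw i j).smul continuousOn_const

theorem bil_cont' {n : ℕ} {X : Type*} [TopologicalSpace X] {w : X → Fin n → Fin n → ℝ}
    (hw : ∀ i j, Continuous (fun x => w x i j)) : Continuous (fun x => bil (w x)) := by
  rw [← continuousOn_univ]
  exact bil_cont fun i j => (hw i j).continuousOn

/-- the vector representing a functional -/
theorem exists_vec {n : ℕ} (p : DD n) : ∃ ξ : EE n, ‖ξ‖ = ‖p‖ ∧
    ∀ i, p (EuclideanSpace.single i 1) = ξ i := by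
  refine ⟨(InnerProductSpace.toDual ℝ (EE n)).symm p, by simp, fun i => ?_⟩
  have h : p = (InnerProductSpace.toDual ℝ (EE n)) ((InnerProductSpace.toDual ℝ (EE n)).symm p) := by simp
  conv_lhs => rw [h]
  rw [InnerProductSpace.toDual_apply_apply, EuclideanSpace.inner_single_right]
  simp

theorem bil_ell {n : ℕ} {Λ : ℝ} (hΛ : 1 ≤ Λ) {a : Fin n → Fin n → ℝ}
    (ha : ∀ ξ : EE n, Λ⁻¹ * ‖ξ‖ ^ 2 ≤ ∑ i : Fin n, ∑ j : Fin n, a i j * ξ i * ξ j ∧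
      ∑ i : Fin n, ∑ j : Fin n, a i j * ξ i * ξ j ≤ Λ * ‖ξ‖ ^ 2) (p : DD n) :
    Λ⁻¹ * ‖p‖ ^ 2 ≤ bil a p p ∧ bil a p p ≤ Λ * ‖p‖ ^ 2 := by
  obtain ⟨ξ, h1, h2⟩ := exists_vec p
  rw [bil_apply]
  simp only [h2, ← h1]
  exact ha ξ

theorem bil_comb {n : ℕ} (a b : Fin n → Fin n → ℝ) (t : ℝ) (p q : DD n) :
    bil (fun i j => b i j + t * (a i j - b i j)) p q = (1 - t) * bil b p q + t * bil a p q := by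
  simp only [bil_apply, Finset.mul_sum, ← Finset.sum_add_distrib]
  refine Finset.sum_congr rfl fun i _ => Finset.sum_congr rfl fun j _ => ?_
  ring

theorem bil_symm {n : ℕ} {a : Fin n → Fin n → ℝ} (ha : ∀ i j, a i j = a j i) (p q : DD n) :
    bil a p q = bil a q p := by
  rw [bil_apply, bil_apply, Finset.sum_comm]
  refine Finset.sum_congr rfl fun i _ => Finset.sum_congr rfl fun j _ => ?_
  rw [ha i j]; ring

theorem id_ell {n : ℕ} {Λ : ℝ} (hΛ : 1 ≤ Λ) (ξ : EE n) :
    Λ⁻¹ * ‖ξ‖ ^ 2 ≤ ∑ i : Fin n, ∑ j : Fin n, (if i = j then (1:ℝ) else 0) * ξ i * ξ j ∧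
      ∑ i : Fin n, ∑ j : Fin n, (if i = j then (1:ℝ) else 0) * ξ i * ξ j ≤ Λ * ‖ξ‖ ^ 2 := by
  have h : ∑ i : Fin n, ∑ j : Fin n, (if i = j then (1:ℝ) else 0) * ξ i * ξ j = ‖ξ‖ ^ 2 := by
    rw [EuclideanSpace.norm_sq_eq]
    simp [ite_mul, pow_two]
  rw [h]
  have h0 : 0 ≤ ‖ξ‖ ^ 2 := sq_nonneg _
  have h1 : Λ⁻¹ ≤ 1 := inv_le_one_of_one_le₀ hΛ
  constructor <;> nlinarith

theorem cont_cut {n : ℕ} {χ w : EE n → ℝ} (hχ : Continuous χ) {r r' : ℝ} (hrr : r < r')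
    (hs : tsupport χ ⊆ closedBall 0 r) (hw : ContinuousOn w (ball 0 r')) :
    Continuous (fun x => χ x * w x) := by
  apply continuous_of_tsupport
  intro x hx
  have hx' : x ∈ ball (0 : EE n) r' :=
    closedBall_subset_ball hrr (hs (tsupport_mul_subset_left hx))
  exact hχ.continuousAt.mul (hw.continuousAt (isOpen_ball.mem_nhds hx'))

theorem contDiff_cut {n : ℕ} {χ w : EE n → ℝ} (hχ : ContDiff ℝ 1 χ) {r r' : ℝ} (hrr : r < r')
    (hs : tsupport χ ⊆ closedBall 0 r) (hw : ContDiffOn ℝ 1 w (ball 0 r')) :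
    ContDiff ℝ 1 (fun x => χ x * w x) := by
  rw [contDiff_iff_contDiffAt]
  intro x
  by_cases hx : x ∈ tsupport (fun x => χ x * w x)
  swap
  · have h0 := notMem_tsupport_iff_eventuallyEq.1 hx
    exact (contDiffAt_const (c := (0:ℝ))).congr_of_eventuallyEq h0
  have hx' : x ∈ ball (0 : EE n) r' :=
    closedBall_subset_ball hrr (hs (tsupport_mul_subset_left hx))
  exact hχ.contDiffAt.mul (hw.contDiffAt (isOpen_ball.mem_nhds hx'))

theorem integral_affine {n : ℕ} (f : EE n → ℝ) (a : EE n) {t : ℝ} (ht : 0 < t) :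
    ∫ x, f (a + t • x) = (t ^ n)⁻¹ * ∫ x, f x := by
  have h1 := Measure.integral_comp_smul (volume : Measure (EE n)) (fun x => f (a + x)) t
  rw [h1, integral_add_left_eq_self (μ := (volume : Measure (EE n))) f a]
  simp [abs_of_pos ht]


noncomputable def HH {n : ℕ} (ρ : EE n → ℝ → ℝ) (f : EE n → ℝ) (F : EE n → ℝ → EE n → ℝ) (φ : EE n → ℝ) :
    EE n → ℝ := fun x =>
  ρ x (φ x) * (1 - (1/2) * f x * Real.exp (φ x) + F x (φ x) (gradient φ x))

theorem norm_gradient {n : ℕ} (φ : EE n → ℝ) (x : EE n) : ‖gradient φ x‖ = ‖fderiv ℝ φ x‖ := by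
  simp [gradient]

section
variable {n : ℕ} {Λ κ : ℝ} {a : Fin n → Fin n → EE n → ℝ → ℝ} {ρ : EE n → ℝ → ℝ} {f : EE n → ℝ}
  {F : EE n → ℝ → EE n → ℝ} {φ : EE n → ℝ}

theorem cont_fderiv_on (hS : IsSolution n κ a ρ f F φ) : ContinuousOn (fderiv ℝ φ) (ball 0 1) :=
  hS.1.continuousOn_fderiv_of_isOpen isOpen_ball le_rfl

theorem cont_coef (hG : GoodCoeffs n Λ a ρ f F) (hS : IsSolution n κ a ρ f F φ) (i j : Fin n) :
    ContinuousOn (fun x => a i j x (φ x)) (ball 0 1) :=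
  (hG.1 i j).comp (continuousOn_id.prodMk hS.1.continuousOn) fun x hx => ⟨hx, mem_univ _⟩

theorem cont_HH (hG : GoodCoeffs n Λ a ρ f F) (hS : IsSolution n κ a ρ f F φ) :
    ContinuousOn (HH ρ f F φ) (ball 0 1) := by
  obtain ⟨-, -, -, g4, -, g6, -, g8, -⟩ := hG
  have cφ := hS.1.continuousOn
  have cg : ContinuousOn (gradient φ) (ball 0 1) :=
    (InnerProductSpace.toDual ℝ (EE n)).symm.continuous.comp_continuousOn (cont_fderiv_on hS)
  have c1 : ContinuousOn (fun x => ρ x (φ x)) (ball 0 1) :=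
    g4.comp (continuousOn_id.prodMk cφ) fun x hx => ⟨hx, mem_univ _⟩
  have c2 : ContinuousOn (fun x => F x (φ x) (gradient φ x)) (ball 0 1) :=
    g8.comp (continuousOn_id.prodMk (cφ.prodMk cg)) fun x hx => ⟨hx, mem_univ _⟩
  exact c1.mul ((continuousOn_const.sub ((continuousOn_const.mul g6).mul cφ.rexp)).add c2)

theorem bound_HH (hG : GoodCoeffs n Λ a ρ f F) (hS : IsSolution n κ a ρ f F φ) {x : EE n}
    (hx : x ∈ ball (0 : EE n) 1) : |HH ρ f F φ x| ≤ 2 * ‖fderiv ℝ φ x‖ ^ 2 + (4 + exp κ) := by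
  obtain ⟨-, -, -, -, g5, -, g7, -, g9⟩ := hG
  have h1 := g9 x hx (φ x) (gradient φ x)
  rw [norm_gradient] at h1
  obtain ⟨h2, h3⟩ := g7 x hx
  obtain ⟨h4, h5⟩ := g5 x hx (φ x)
  have h6 : exp (φ x) ≤ exp κ := exp_le_exp.2 (hS.2.1 x hx).2
  have h7 := exp_pos (φ x)
  unfold HH
  rw [abs_mul, abs_of_nonneg (by linarith)]
  have h8 : |1 - 1 / 2 * f x * exp (φ x) + F x (φ x) (gradient φ x)|
      ≤ ‖fderiv ℝ φ x‖ ^ 2 + 2 + exp κ / 2 := by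
    have h9 : 0 ≤ f x * exp (φ x) := by positivity
    have h10 : f x * exp (φ x) ≤ exp κ := by nlinarith
    rw [abs_le] at h1 ⊢
    constructor <;> nlinarith
  have := abs_nonneg (1 - 1 / 2 * f x * exp (φ x) + F x (φ x) (gradient φ x))
  nlinarith

theorem weak_sol (hG : GoodCoeffs n Λ a ρ f F) (hS : IsSolution n κ a ρ f F φ)
    {ψ : EE n → ℝ} (hψ : IsTest ψ) :
    ∫ x, bil (fun i j => a i j x (φ x)) (fderiv ℝ φ x) (fderiv ℝ ψ x) = ∫ x, HH ρ f F φ x * ψ x := by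
  refine weak_C1 (G := fun x => bil (fun i j => a i j x (φ x)) (fderiv ℝ φ x))
    ((bil_cont (cont_coef hG hS)).clm_apply (cont_fderiv_on hS)) (cont_HH hG hS) ?_ hψ
  intro ψ h1 h2 h3
  simp only [bil_apply]
  exact hS.2.2 ψ h1 h2 h3

theorem reduce (hΛ : 1 ≤ Λ) (hG : GoodCoeffs n Λ a ρ f F) (hS : IsSolution n κ a ρ f F φ)
    {x0 : EE n} (hx0 : x0 ∈ ball (0 : EE n) (1/2)) {R : ℝ} (hR : 0 < R) (hR1 : R ≤ 1/4) {σ m : ℝ}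
    (hσ : σ ^ 2 = 1) (hm : ∀ x ∈ ball x0 (2 * R), σ * φ x ≤ m) :
    ∃ (A : EE n → DD n →L[ℝ] DD n →L[ℝ] ℝ) (u : EE n → ℝ), Ell n Λ A ∧ ContDiff ℝ 1 u ∧
      (∀ x, u x ≤ 0) ∧ SubSol A u (fun x => 2 * ‖fderiv ℝ u x‖ ^ 2 + R ^ 2 * (4 + exp κ)) ∧
      ∀ x ∈ closedBall (0 : EE n) 1, u x = σ * φ (x0 + R • x) - m := by
  obtain ⟨_, _, hcut⟩ := exists_cutoff
  obtain ⟨χ, e1, e2, e3, e4, e5, e6, -⟩ := hcut n 1 (3/2) (by norm_num) (by norm_num)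
  have hχ1 : ContDiff ℝ 1 χ := e1.of_le (by exact_mod_cast le_top)
  have hT0 : ∀ x ∈ ball (0 : EE n) 2, x0 + R • x ∈ ball x0 (2 * R) := by
    intro x hx
    rw [mem_ball_zero_iff] at hx
    rw [mem_ball, dist_eq_norm, add_sub_cancel_left, norm_smul, Real.norm_of_nonneg hR.le]
    nlinarith
  have hB : ball x0 (2 * R) ⊆ ball (0 : EE n) 1 := by
    apply ball_subset_ball'
    rw [mem_ball] at hx0; linarith
  have hT : ∀ x ∈ ball (0 : EE n) 2, x0 + R • x ∈ ball (0 : EE n) 1 := fun x hx => hB (hT0 x hx)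
  have cT : Continuous (fun x : EE n => x0 + R • x) := by fun_prop
  have dT : ContDiff ℝ 1 (fun x : EE n => x0 + R • x) := by fun_prop
  set w : EE n → Fin n → Fin n → ℝ := fun x i j =>
    (if i = j then (1:ℝ) else 0) + χ x * (a i j (x0 + R • x) (φ (x0 + R • x)) - (if i = j then (1:ℝ) else 0)) with hw
  set A : EE n → DD n →L[ℝ] DD n →L[ℝ] ℝ := fun x => bil (w x) with hA
  set u : EE n → ℝ := fun x => χ x * (σ * φ (x0 + R • x) - m) with hu
  have hball : ∀ x, x ∉ ball (0 : EE n) 2 → χ x = 0 := fun x hx => by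
    apply test_zero
    intro h; exact hx (closedBall_subset_ball (by norm_num) (e5 h))
  have hell : Ell n Λ A := by
    have hq : ∀ x p, Λ⁻¹ * ‖p‖ ^ 2 ≤ A x p p ∧ A x p p ≤ Λ * ‖p‖ ^ 2 := by
      intro x p
      have hI := bil_ell hΛ (id_ell (n := n) hΛ) p
      have hc : A x p p = (1 - χ x) * bil (fun i j : Fin n => if i = j then (1:ℝ) else 0) p p
          + χ x * bil (fun i j => a i j (x0 + R • x) (φ (x0 + R • x))) p p :=
        bil_comb _ _ _ p p
      rw [hc]
      by_cases hx : x ∈ ball (0 : EE n) 2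
      · have h1 := bil_ell hΛ (hG.2.2.1 _ (hT x hx) (φ (x0 + R • x))) p
        have h2 := e2 x
        have h3 := e3 x
        constructor <;> nlinarith
      · rw [hball x hx]; simpa using hI
    refine ⟨bil_cont' fun i j => ?_, fun x p q => bil_symm (fun i j => ?_) p q,
      fun x p => (hq x p).1, fun x p => (hq x p).2⟩
    · refine continuous_const.add (cont_cut hχ1.continuous (by norm_num : (3/2:ℝ) < 2) e5 ?_)
      exact ((cont_coef hG hS i j).comp cT.continuousOn hT).sub continuousOn_const
    · simp only [hw]
      rw [hG.2.1 i j]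
      simp only [eq_comm]
  have hu1 : ContDiff ℝ 1 u := by
    apply contDiff_cut hχ1 (by norm_num : (3/2:ℝ) < 2) e5
    exact (contDiffOn_const.mul (hS.1.comp dT.contDiffOn hT)).sub contDiffOn_const
  have hueq : ∀ x ∈ closedBall (0 : EE n) 1, u x = σ * φ (x0 + R • x) - m := fun x hx => by
    simp only [hu, e4 x hx, one_mul]
  have hsub2 : ball (0 : EE n) 1 ⊆ ball 0 2 := ball_subset_ball (by norm_num)
  have hDu : ∀ x ∈ ball (0 : EE n) 1, fderiv ℝ u x = (σ * R) • fderiv ℝ φ (x0 + R • x) := by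
    intro x hx
    have h1 : u =ᶠ[nhds x] fun x => σ * φ (x0 + R • x) - m := by
      filter_upwards [isOpen_ball.mem_nhds hx] with y hy
      exact hueq y (ball_subset_closedBall hy)
    rw [h1.fderiv_eq]
    have h2 : HasFDerivAt φ (fderiv ℝ φ (x0 + R • x)) (x0 + R • x) :=
      ((hS.1.contDiffAt (isOpen_ball.mem_nhds (hT x (hsub2 hx)))).differentiableAt (by norm_num)).hasFDerivAt
    have h3 : HasFDerivAt (fun x : EE n => x0 + R • x) (R • ContinuousLinearMap.id ℝ (EE n)) x :=
      ((hasFDerivAt_id x).const_smul R).const_add x0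
    have h4 := (((h2.comp x h3).const_mul σ).sub_const m).fderiv
    refine Eq.trans h4 ?_
    ext y
    simp [mul_assoc]
  refine ⟨A, u, hell, hu1, fun x => ?_, ?_, hueq⟩
  · by_cases hx : x ∈ ball (0 : EE n) 2
    · have := hm _ (hT0 x hx)
      have := e2 x
      simp only [hu]; nlinarith
    · simp only [hu, hball x hx]; simp
  intro ψ hψ hψ0
  -- pull back the test function
  set Ψ : EE n → ℝ := fun y => ψ (R⁻¹ • (y - x0)) with hΨ
  have hinv : ∀ x : EE n, R⁻¹ • ((x0 + R • x) - x0) = x := fun x => by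
    rw [add_sub_cancel_left, smul_smul, inv_mul_cancel₀ hR.ne', one_smul]
  have hΨsupp : tsupport Ψ ⊆ (fun x => x0 + R • x) '' tsupport ψ := by
    apply closure_minimal
    · intro y hy
      refine ⟨R⁻¹ • (y - x0), subset_tsupport _ hy, ?_⟩
      simp [smul_smul, hR.ne']
    · exact (hψ.2.1.isCompact.image cT).isClosed
  have hΨt : IsTest Ψ := by
    refine ⟨hψ.1.comp (by fun_prop), ?_, ?_⟩
    · exact (hψ.2.1.isCompact.image cT).of_isClosed_subset (isClosed_tsupport _) hΨsupp
    · rintro y hy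
      obtain ⟨x, hx, rfl⟩ := hΨsupp hy
      exact hT x (hsub2 (hψ.2.2 hx))
  have hDΨ : ∀ x, fderiv ℝ Ψ (x0 + R • x) = R⁻¹ • fderiv ℝ ψ x := by
    intro x
    have h2 : HasFDerivAt ψ (fderiv ℝ ψ x) (R⁻¹ • ((x0 + R • x) - x0)) := by
      rw [hinv]; exact (hψ.1.differentiable (by norm_num) x).hasFDerivAt
    have h3 : HasFDerivAt (fun y : EE n => R⁻¹ • (y - x0)) (R⁻¹ • ContinuousLinearMap.id ℝ (EE n)) (x0 + R • x) :=
      ((hasFDerivAt_id _).sub_const x0).const_smul R⁻¹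
    refine Eq.trans (h2.comp (x0 + R • x) h3).fderiv ?_
    ext y; simp
  have key := weak_sol hG hS hΨt
  have k1 := integral_affine (fun x => bil (fun i j => a i j x (φ x)) (fderiv ℝ φ x) (fderiv ℝ Ψ x)) x0 hR
  have k2 := integral_affine (fun x => HH ρ f F φ x * Ψ x) x0 hR
  rw [key, ← k2] at k1
  have hΨx : ∀ x, Ψ (x0 + R • x) = ψ x := fun x => by simp only [hΨ, hinv]
  simp only [hDΨ, hΨx] at k1
  have hLHS : ∫ x, A x (fderiv ℝ u x) (fderiv ℝ ψ x)
      = ∫ x, (σ * R ^ 2) * (HH ρ f F φ (x0 + R • x) * ψ x) := by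
    rw [integral_const_mul, ← k1, ← integral_const_mul]
    congr 1
    ext x
    by_cases hx : x ∈ tsupport ψ
    · have hx1 := hψ.2.2 hx
      rw [hDu x hx1]
      have : A x = bil (fun i j => a i j (x0 + R • x) (φ (x0 + R • x))) := by
        simp only [hA]; congr 1; ext i j; simp only [hw, e4 x (ball_subset_closedBall hx1)]; ring
      rw [this]
      simp only [map_smul, smul_apply, smul_eq_mul]
      field_simp
    · rw [test_fzero hx]; simp
  rw [hLHS]
  have hKball : tsupport ψ ⊆ ball (0 : EE n) 1 := hψ.2.2
  have i1 : Integrable (fun x => (σ * R ^ 2) * (HH ρ f F φ (x0 + R • x) * ψ x)) := by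
    apply Integrable.const_mul
    rw [← integrableOn_iff_integrable_of_support_subset (s := tsupport ψ)]
    · apply ContinuousOn.integrableOn_compact hψ.2.1.isCompact
      exact ((cont_HH hG hS).comp cT.continuousOn fun x hx => hT x (hsub2 (hKball hx))).mul
        hψ.1.continuous.continuousOn
    · intro x hx
      by_contra hc
      exact hx (by simp [test_zero hc])
  have i2 : Integrable (fun x => (2 * ‖fderiv ℝ u x‖ ^ 2 + R ^ 2 * (4 + exp κ)) * ψ x) :=
    integrable_of_zero ((((cont_fd hu1).norm.pow 2).const_mul 2 |>.add continuous_const).mul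
      hψ.1.continuous) hψ.2.1 (fun x hx => by simp [test_zero hx])
  apply integral_mono i1 i2
  intro x
  by_cases hx : x ∈ tsupport ψ
  · have hx1 := hψ.2.2 hx
    have hb := bound_HH hG hS (hT x (hsub2 hx1))
    simp only
    rw [hDu x hx1, norm_smul, mul_pow, Real.norm_eq_abs, sq_abs, mul_pow, hσ, one_mul, ← mul_assoc]
    apply mul_le_mul_of_nonneg_right _ (hψ0 x)
    have hσ1 : |σ| = 1 := by
      have := sq_abs σ
      rw [hσ] at this
      nlinarith [abs_nonneg σ]
    have h1 : σ * HH ρ f F φ (x0 + R • x) ≤ |HH ρ f F φ (x0 + R • x)| := by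
      calc _ ≤ |σ * HH ρ f F φ (x0 + R • x)| := le_abs_self _
        _ = _ := by rw [abs_mul, hσ1, one_mul]
    have h2 : 0 < R ^ 2 := by positivity
    nlinarith
  · simp [test_zero hx]
end

/-- On the ball of radius `r` about `x0`, the function `φ` takes values in an interval of length at most `ω`. -/
def OscLe {n : ℕ} (φ : EE n → ℝ) (x0 : EE n) (r ω : ℝ) : Prop :=
  ∃ m M : ℝ, (∀ x ∈ ball x0 r, m ≤ φ x ∧ φ x ≤ M) ∧ M - m ≤ ω

theorem osc_step (n : ℕ) (hn : 2 ≤ n) {Λ : ℝ} (hΛ : 1 ≤ Λ) : ∃ c : ℝ, 0 < c ∧ c ≤ 1/2 ∧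
    ∀ (κ : ℝ), 1 ≤ κ → ∀ (a : Fin n → Fin n → EE n → ℝ → ℝ) (ρ : EE n → ℝ → ℝ) (f : EE n → ℝ)
      (F : EE n → ℝ → EE n → ℝ) (φ : EE n → ℝ), GoodCoeffs n Λ a ρ f F → IsSolution n κ a ρ f F φ →
      ∀ x0 ∈ ball (0 : EE n) (1/2), ∀ r ω : ℝ, 0 < r → r ≤ 1/2 → OscLe φ x0 r ω →
      OscLe φ x0 (r / 8) ((1 - c * exp (-(4 * Λ * κ))) * ω + 2 * r ^ 2 * exp κ) := by
  obtain ⟨c, hc, hc2, hgr⟩ := growth n hn hΛ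
  refine ⟨c, hc, hc2, fun κ hκ a ρ f F φ hG hS x0 hx0 r ω hr hr2 hosc => ?_⟩
  obtain ⟨m1, M1, hb1, hω⟩ := hosc
  set R := r / 2 with hR
  have hR0 : 0 < R := by positivity
  have h2R : 2 * R = r := by rw [hR]; ring
  have hsub : ball x0 r ⊆ ball (0 : EE n) 1 := by
    apply ball_subset_ball'
    rw [mem_ball] at hx0; linarith
  set m := max m1 0 with hm
  set M := min M1 κ with hM
  have hb : ∀ x ∈ ball x0 r, m ≤ φ x ∧ φ x ≤ M := fun x hx =>
    ⟨max_le (hb1 x hx).1 (hS.2.1 x (hsub hx)).1, le_min (hb1 x hx).2 (hS.2.1 x (hsub hx)).2⟩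
  have hMω : M - m ≤ ω := by linarith [le_max_left m1 0, min_le_left M1 κ]
  have hMκ : M - m ≤ κ := by linarith [le_max_right m1 0, min_le_right M1 κ]
  have hmM : m ≤ M := (hb x0 (mem_ball_self hr)).1.trans (hb x0 (mem_ball_self hr)).2
  set δ := c * exp (-(4 * Λ * κ)) with hδ
  have hδ0 : 0 < δ := by positivity
  have hδ1 : δ ≤ 1/2 := by
    have : exp (-(4 * Λ * κ)) ≤ 1 := exp_le_one_iff.2 (by nlinarith)
    nlinarith
  set μ := R ^ 2 * (4 + exp κ) with hμ
  have hμ0 : 0 < μ := by positivity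
  have hμ1 : μ ≤ 2 * r ^ 2 * exp κ := by
    have : 1 ≤ exp κ := one_le_exp (by linarith)
    have h4 : R ^ 2 = r ^ 2 / 4 := by rw [hR]; ring
    rw [hμ, h4]
    have : 0 < r ^ 2 := by positivity
    nlinarith
  have hsub8 : ball x0 (r / 8) ⊆ ball x0 r := ball_subset_ball (by linarith)
  rcases hmM.eq_or_lt with heq | hlt
  · refine ⟨m, M, fun x hx => hb x (hsub8 hx), ?_⟩
    have : 0 ≤ ω := by linarith
    have : 0 ≤ (1 - δ) * ω := mul_nonneg (by linarith) this
    linarith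
  set d := (M - m) / 2 with hd
  have hd0 : 0 < d := by rw [hd]; linarith
  have hdec : δ * (M - m) ≤ c * (1 - exp (-(2 * Λ * d))) := by
    have ht : 2 * Λ * d = Λ * (M - m) := by rw [hd]; ring
    rw [ht, hδ, mul_assoc]
    apply mul_le_mul_of_nonneg_left _ hc.le
    set t := Λ * (M - m) with ht'
    have ht0 : M - m ≤ t := by nlinarith
    have h1 : t * exp (-t) ≤ 1 - exp (-t) := by
      have h2 := Real.add_one_le_exp t
      have h3 : exp t * exp (-t) = 1 := by rw [← exp_add]; simp
      have h4 := exp_pos (-t)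
      nlinarith
    have h5 : exp (-(4 * Λ * κ)) ≤ exp (-t) := exp_le_exp.2 (by nlinarith)
    have h6 := exp_pos (-(4 * Λ * κ))
    nlinarith
  have hfin : M - m - c * (1 - exp (-(2 * Λ * d))) + μ ≤ (1 - δ) * ω + 2 * r ^ 2 * exp κ := by
    nlinarith
  -- the two halves
  have hcov : ball (0 : EE n) (3/4) ⊆ ({x | φ (x0 + R • x) ≤ M - d} ∩ ball (0 : EE n) (3/4))
      ∪ ({x | m + d ≤ φ (x0 + R • x)} ∩ ball (0 : EE n) (3/4)) := by
    intro x hx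
    rcases le_total (φ (x0 + R • x)) (M - d) with h | h
    · exact Or.inl ⟨h, hx⟩
    · refine Or.inr ⟨?_, hx⟩
      have : m + d = M - d := by rw [hd]; ring
      change m + d ≤ _
      rw [this]; exact h
  have hvol := (measure_mono hcov).trans (measure_union_le (μ := volume) _ _)
  have hcases : volume (ball (0 : EE n) (3/4)) ≤ 2 * volume ({x | φ (x0 + R • x) ≤ M - d} ∩ ball (0 : EE n) (3/4))
      ∨ volume (ball (0 : EE n) (3/4)) ≤ 2 * volume ({x | m + d ≤ φ (x0 + R • x)} ∩ ball (0 : EE n) (3/4)) := by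
    rcases le_total (volume ({x | φ (x0 + R • x) ≤ M - d} ∩ ball (0 : EE n) (3/4)))
      (volume ({x | m + d ≤ φ (x0 + R • x)} ∩ ball (0 : EE n) (3/4))) with h | h
    · right; refine hvol.trans ?_; rw [two_mul]; gcongr
    · left; refine hvol.trans ?_; rw [two_mul]; gcongr
  have hpt : ∀ x ∈ ball x0 (r / 8), R⁻¹ • (x - x0) ∈ ball (0 : EE n) (1/4) ∧ x0 + R • (R⁻¹ • (x - x0)) = x := by
    intro x hx
    constructor
    · rw [mem_ball, dist_eq_norm] at hx
      rw [mem_ball_zero_iff, norm_smul, norm_inv, Real.norm_of_nonneg hR0.le, inv_mul_lt_iff₀ hR0]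
      rw [hR]; linarith
    · rw [smul_smul, mul_inv_cancel₀ hR0.ne', one_smul]; abel
  have h34 : ball (0 : EE n) (3/4) ⊆ closedBall 0 1 :=
    (ball_subset_ball (by norm_num)).trans ball_subset_closedBall
  have h14 : ball (0 : EE n) (1/4) ⊆ closedBall 0 1 :=
    (ball_subset_ball (by norm_num)).trans ball_subset_closedBall
  rcases hcases with hv | hv
  · obtain ⟨A, u, hA, hu, hu0, hsu, hue⟩ := reduce hΛ hG hS hx0 hR0 (by linarith) (σ := 1) (m := M)
      (by norm_num) (fun x hx => by rw [one_mul]; exact (hb x (h2R ▸ hx)).2)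
    have hset : {x | φ (x0 + R • x) ≤ M - d} ∩ ball (0 : EE n) (3/4) = {x | u x ≤ -d} ∩ ball (0 : EE n) (3/4) := by
      ext x
      simp only [mem_inter_iff, mem_ofPred_eq, and_congr_left_iff]
      intro hx
      rw [hue x (h34 hx)]
      constructor <;> intro h <;> linarith
    rw [hset] at hv
    have hg := hgr A hA u hu μ hμ0 hu0 hsu d hd0 hv
    refine ⟨m, M - c * (1 - exp (-(2 * Λ * d))) + μ, fun x hx => ⟨(hb x (hsub8 hx)).1, ?_⟩, by linarith⟩
    obtain ⟨h1, h2⟩ := hpt x hx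
    have h3 := hg _ h1
    rw [hue _ (h14 h1), h2] at h3
    linarith
  · obtain ⟨A, u, hA, hu, hu0, hsu, hue⟩ := reduce hΛ hG hS hx0 hR0 (by linarith) (σ := -1) (m := -m)
      (by norm_num) (fun x hx => by linarith [(hb x (h2R ▸ hx)).1])
    have hset : {x | m + d ≤ φ (x0 + R • x)} ∩ ball (0 : EE n) (3/4) = {x | u x ≤ -d} ∩ ball (0 : EE n) (3/4) := by
      ext x
      simp only [mem_inter_iff, mem_ofPred_eq, and_congr_left_iff]
      intro hx
      rw [hue x (h34 hx)]
      constructor <;> intro h <;> linarith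
    rw [hset] at hv
    have hg := hgr A hA u hu μ hμ0 hu0 hsu d hd0 hv
    refine ⟨m + c * (1 - exp (-(2 * Λ * d))) - μ, M, fun x hx => ⟨?_, (hb x (hsub8 hx)).2⟩, by linarith⟩
    obtain ⟨h1, h2⟩ := hpt x hx
    have h3 := hg _ h1
    rw [hue _ (h14 h1), h2] at h3
    linarith

theorem holder_final (n : ℕ) (hn : 2 ≤ n) (Λ : ℝ) (hΛ : 1 ≤ Λ) :
    ∃ C > (0:ℝ), ∃ ε₀ ∈ Set.Ioo (0:ℝ) 1,
      ∀ κ : ℝ, 1 ≤ κ →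
        ε₀ * Real.exp (-(4 * Λ * κ)) ∈ Set.Ioo (0:ℝ) 1 ∧
        ∀ (a : Fin n → Fin n → EuclideanSpace ℝ (Fin n) → ℝ → ℝ)
          (ρ : EuclideanSpace ℝ (Fin n) → ℝ → ℝ)
          (f : EuclideanSpace ℝ (Fin n) → ℝ)
          (F : EuclideanSpace ℝ (Fin n) → ℝ → EuclideanSpace ℝ (Fin n) → ℝ),
          GoodCoeffs n Λ a ρ f F →
          ∀ φ : EuclideanSpace ℝ (Fin n) → ℝ, IsSolution n κ a ρ f F φ →
          ∀ x ∈ ball (0 : EuclideanSpace ℝ (Fin n)) (1/2),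
          ∀ y ∈ ball (0 : EuclideanSpace ℝ (Fin n)) (1/2),
            |φ x - φ y| ≤ C * Real.exp κ * ‖x - y‖ ^ (ε₀ * Real.exp (-(4 * Λ * κ))) := by
  obtain ⟨c, hc, hc2, hstep⟩ := osc_step n hn hΛ
  refine ⟨96, by norm_num, c / 3, ⟨by positivity, by linarith⟩, fun κ hκ => ?_⟩
  have hexp : exp (-(4 * Λ * κ)) ≤ 1 := exp_le_one_iff.2 (by nlinarith)
  have hexp0 := exp_pos (-(4 * Λ * κ))
  set α := c / 3 * exp (-(4 * Λ * κ)) with hα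
  set δ := c * exp (-(4 * Λ * κ)) with hδ
  have hαδ : δ = 3 * α := by rw [hα, hδ]; ring
  have hα0 : 0 < α := by positivity
  have hδ1 : δ ≤ 1/2 := by rw [hδ]; nlinarith
  have hα1 : α < 1 := by linarith
  refine ⟨⟨hα0, hα1⟩, fun a ρ f F hG φ hS x hx y hy => ?_⟩
  have hsub : ball (0 : EE n) (1/2) ⊆ ball 0 1 := ball_subset_ball (by norm_num)
  have hκe : κ ≤ exp κ := by linarith [Real.add_one_le_exp κ]
  have hiter : ∀ k : ℕ, OscLe φ x ((1/2) * (1/8) ^ k) (exp κ * (3 * (1 - δ) ^ k - 2 * (1/64) ^ k)) := by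
    intro k
    induction k with
    | zero =>
      refine ⟨0, κ, fun z hz => hS.2.1 z ?_, by simp; linarith⟩
      refine ball_subset_ball' ?_ hz
      rw [mem_ball] at hx; rw [pow_zero]; linarith
    | succ k ih =>
      have h8 : (0:ℝ) < (1/8) ^ k := by positivity
      have h81 : ((1/8 : ℝ)) ^ k ≤ 1 := pow_le_one₀ (by norm_num) (by norm_num)
      obtain ⟨m, M, h1, h2⟩ := hstep κ hκ a ρ f F φ hG hS x hx _ _ (by positivity) (by linarith) ih
      have er : (1/2 : ℝ) * (1/8) ^ k / 8 = (1/2) * (1/8) ^ (k+1) := by rw [pow_succ]; ring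
      rw [er] at h1
      refine ⟨m, M, h1, h2.trans ?_⟩
      have e64 : ((1/8 : ℝ) ^ k) ^ 2 = (1/64) ^ k := by rw [← pow_mul, mul_comm, pow_mul]; norm_num
      have h64 : (0:ℝ) < (1/64) ^ k := by positivity
      have : (1 - δ) * (exp κ * (3 * (1 - δ) ^ k - 2 * (1/64) ^ k)) + 2 * ((1/2) * (1/8) ^ k) ^ 2 * exp κ
          = exp κ * (3 * (1 - δ) ^ (k+1) - 2 * (1 - δ) * (1/64) ^ k + (1/2) * (1/64) ^ k) := by
        rw [mul_pow, e64, pow_succ]; ring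
      rw [this]
      apply mul_le_mul_of_nonneg_left _ (exp_pos κ).le
      rw [pow_succ ((1:ℝ)/64)]
      nlinarith
  rcases eq_or_ne x y with rfl | hxy
  · simp; positivity
  have hr : 0 < ‖x - y‖ := norm_pos_iff.2 (sub_ne_zero.2 hxy)
  have hpowle : ∀ t : ℝ, 0 < t → t ≤ 1 → t ≤ t ^ α := fun t h0 h1 => by
    calc t = t ^ (1:ℝ) := (Real.rpow_one t).symm
      _ ≤ t ^ α := Real.rpow_le_rpow_of_exponent_ge h0 h1 hα1.le
  rcases le_total (1/4) ‖x - y‖ with hbig | hsmall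
  · have h1 : (1/4 : ℝ) ≤ ‖x - y‖ ^ α :=
      (hpowle (1/4) (by norm_num) (by norm_num)).trans (Real.rpow_le_rpow (by norm_num) hbig hα0.le)
    have h2 : |φ x - φ y| ≤ κ := by
      have a1 := hS.2.1 x (hsub hx)
      have a2 := hS.2.1 y (hsub hy)
      rw [abs_le]; constructor <;> linarith
    have := exp_pos κ
    nlinarith
  · obtain ⟨k, hk1, hk2⟩ := exists_nat_pow_near_of_lt_one (x := 4 * ‖x - y‖) (y := 1/8)
      (by linarith) (by linarith) (by norm_num) (by norm_num)
    obtain ⟨m, M, hb, hMm⟩ := hiter k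
    have h8 : (0:ℝ) < (1/8) ^ k := by positivity
    have bx := hb x (mem_ball_self (by positivity))
    have hyb := hb y (by rw [mem_ball, dist_comm, dist_eq_norm]; linarith)
    have h64 : (0:ℝ) < (1/64) ^ k := by positivity
    have hosc : |φ x - φ y| ≤ exp κ * (3 * (1 - δ) ^ k) := by
      have : exp κ * (3 * (1 - δ) ^ k - 2 * (1/64) ^ k) ≤ exp κ * (3 * (1 - δ) ^ k) := by
        apply mul_le_mul_of_nonneg_left _ (exp_pos κ).le; linarith
      rw [abs_le]; constructor <;> linarith
    have hlow : (1/32) * (1 - δ) ^ k ≤ ‖x - y‖ ^ α := by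
      have h1 : (1/32 : ℝ) * (1/8) ^ k ≤ ‖x - y‖ := by rw [pow_succ] at hk1; linarith
      have h2 : 1 - δ ≤ (1/8 : ℝ) ^ α := by
        rw [Real.rpow_def_of_pos (by norm_num)]
        have h3 : log (1/8) = -(3 * log 2) := by
          rw [one_div, Real.log_inv, show (8:ℝ) = 2 ^ 3 by norm_num, Real.log_pow]; norm_num
        rw [h3]
        have h4 := Real.add_one_le_exp (-(3 * log 2) * α)
        have h5 := Real.log_two_lt_d9
        nlinarith
      calc (1/32) * (1 - δ) ^ k ≤ (1/32 : ℝ) ^ α * ((1/8 : ℝ) ^ α) ^ k := by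
            have hd0 : 0 ≤ 1 - δ := by linarith
            exact mul_le_mul (hpowle _ (by norm_num) (by norm_num)) (pow_le_pow_left₀ hd0 h2 k)
              (by positivity) (by positivity)
        _ = ((1/32 : ℝ) * (1/8) ^ k) ^ α := by
            rw [Real.mul_rpow (by norm_num) (by positivity), ← Real.rpow_natCast, ← Real.rpow_natCast,
              ← Real.rpow_mul (by norm_num), ← Real.rpow_mul (by norm_num), mul_comm α]
        _ ≤ _ := Real.rpow_le_rpow (by positivity) h1 hα0.le
    calc |φ x - φ y| ≤ exp κ * (3 * (1 - δ) ^ k) := hosc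
      _ = 96 * exp κ * ((1/32) * (1 - δ) ^ k) := by ring
      _ ≤ _ := by gcongr

end

/-- **Interior Hölder estimate** (Theorem 4.2 / `theorem-Holder-solution`):
there are constants `C > 0` and `ε₀ ∈ (0,1)` depending only on `n` and `Λ` such that,
with `α = ε₀ e^{-4Λκ} ∈ (0,1)`, every solution `φ` satisfies
`|φ(x) - φ(y)| ≤ C e^κ |x - y|^α` for all `x, y ∈ B_{1/2}`. -/
theorem interior_Holder_estimate (n : ℕ) (hn : 2 ≤ n) (Λ : ℝ) (hΛ : 1 ≤ Λ) :
    ∃ C > (0:ℝ), ∃ ε₀ ∈ Set.Ioo (0:ℝ) 1,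
      ∀ κ : ℝ, 1 ≤ κ →
        ε₀ * Real.exp (-(4 * Λ * κ)) ∈ Set.Ioo (0:ℝ) 1 ∧
        ∀ (a : Fin n → Fin n → EuclideanSpace ℝ (Fin n) → ℝ → ℝ)
          (ρ : EuclideanSpace ℝ (Fin n) → ℝ → ℝ)
          (f : EuclideanSpace ℝ (Fin n) → ℝ)
          (F : EuclideanSpace ℝ (Fin n) → ℝ → EuclideanSpace ℝ (Fin n) → ℝ),
          GoodCoeffs n Λ a ρ f F →
          ∀ φ : EuclideanSpace ℝ (Fin n) → ℝ, IsSolution n κ a ρ f F φ →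
          ∀ x ∈ ball (0 : EuclideanSpace ℝ (Fin n)) (1/2),
          ∀ y ∈ ball (0 : EuclideanSpace ℝ (Fin n)) (1/2),
            |φ x - φ y| ≤ C * Real.exp κ * ‖x - y‖ ^ (ε₀ * Real.exp (-(4 * Λ * κ))) := by
  exact holder_final n hn Λ hΛ
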